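/- arXiv:1711.08669 — 2 statements merged into one kernel-verified Lean document; each statement's English description precedes it below -/
import Mathlib

section
/- Let (A, G) be any of the pairs defining a quantum Kleinian singularity: (i) A = k_q[u,v] with G cyclic of order n acting by g·u = ωu, g·v = ω^{−1}v for ω a primitive nth root of unity; (ii) A = k_{−1}[u,v] with G = S_2 acting by h·u = v, h·v = u; (iii) A = k_{−1}[u,v] with G = D_n the dihedral group of order 2n acting by g·u = ωu, g·v = ω^{−1}v, h·u = v, h·v = u; (iv) A = k_J[u,v] with G = C_2 acting by u ↦ −u, v ↦ −v. Then the invariant ring A^G is a maximal order. -/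
/-- `f : R →+* Q` exhibits `Q` as the (Goldie) classical quotient ring of `R`:
regular elements become units and every element of `Q` is left and a right fraction. -/
structure IsGoldieQuotientRing {R Q : Type*} [Ring R] [Ring Q] (f : R →+* Q) : Prop where
  injective : Function.Injective f
  isUnit_of_regular : ∀ r : R, IsRegular r → IsUnit (f r)
  right_fraction : ∀ q : Q, ∃ a s : R, IsRegular s ∧ q * f s = f a
  left_fraction : ∀ q : Q, ∃ a s : R, IsRegular s ∧ f s * q = f a

/-- `R` (viewed inside its quotient ring `Q` via `f`) is a *maximal order*: there is no
ring `R ⊊ R' ⊆ Q` with `a R' b ⊆ R` for some nonzero `a, b ∈ R`. -/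
def IsMaximalOrder {R Q : Type*} [Ring R] [Ring Q] (f : R →+* Q) : Prop :=
  ¬ ∃ R' : Subring Q, f.range < R' ∧ ∃ a b : R, a ≠ 0 ∧ b ≠ 0 ∧
      ∀ x ∈ R', f a * x * f b ∈ f.range

/-- The fixed subring `R^G` of a (semi)group action by ring automorphisms. -/
def fixedSubring (G : Type*) [Monoid G] (R : Type*) [Ring R] [MulSemiringAction G R] :
    Subring R where
  carrier := {x | ∀ g : G, g • x = x}
  mul_mem' := by intro a b ha hb; intro g; rw [smul_mul', ha g, hb g]
  one_mem' := by intro g; exact smul_one g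
  add_mem' := by intro a b ha hb; intro g; rw [smul_add, ha g, hb g]
  zero_mem' := by intro g; exact smul_zero g
  neg_mem' := by intro a ha; intro g; rw [smul_neg, ha g]

/-- The relation defining the quantum plane `K_q[u,v]`: `v u = q · u v`. -/
inductive QuantumRel (K : Type*) [CommRing K] (q : K) :
    FreeAlgebra K (Fin 2) → FreeAlgebra K (Fin 2) → Prop
  | rel : QuantumRel K q (FreeAlgebra.ι K 1 * FreeAlgebra.ι K 0)
      (q • (FreeAlgebra.ι K 0 * FreeAlgebra.ι K 1))

/-- The quantum plane `K_q[u,v] = K⟨u,v⟩/(vu - q·uv)`. -/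
abbrev QuantumPlane (K : Type*) [CommRing K] (q : K) := RingQuot (QuantumRel K q)

/-- The generator `u` of the quantum plane. -/
noncomputable def qU (K : Type*) [CommRing K] (q : K) : QuantumPlane K q :=
  RingQuot.mkAlgHom K (QuantumRel K q) (FreeAlgebra.ι K 0)

/-- The generator `v` of the quantum plane. -/
noncomputable def qV (K : Type*) [CommRing K] (q : K) : QuantumPlane K q :=
  RingQuot.mkAlgHom K (QuantumRel K q) (FreeAlgebra.ι K 1)

/-- The relation defining the Jordan plane `K_J[u,v]`: `v u = u v + u²`. -/
inductive JordanRel (K : Type*) [CommRing K] :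
    FreeAlgebra K (Fin 2) → FreeAlgebra K (Fin 2) → Prop
  | rel : JordanRel K (FreeAlgebra.ι K 1 * FreeAlgebra.ι K 0)
      (FreeAlgebra.ι K 0 * FreeAlgebra.ι K 1 + FreeAlgebra.ι K 0 * FreeAlgebra.ι K 0)

/-- The Jordan plane `K_J[u,v] = K⟨u,v⟩/(vu - uv - u²)`. -/
abbrev JordanPlane (K : Type*) [CommRing K] := RingQuot (JordanRel K)

/-- The generator `u` of the Jordan plane. -/
noncomputable def jU (K : Type*) [CommRing K] : JordanPlane K :=
  RingQuot.mkAlgHom K (JordanRel K) (FreeAlgebra.ι K 0)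

/-- The generator `v` of the Jordan plane. -/
noncomputable def jV (K : Type*) [CommRing K] : JordanPlane K :=
  RingQuot.mkAlgHom K (JordanRel K) (FreeAlgebra.ι K 1)

/-- `u` and `v` generate a plane `v u = q u v + c u²` with basis the ordered monomials `uⁱ vʲ`. -/
structure IsPlane {k A : Type*} [Field k] [Ring A] [Algebra k A] (u v : A) (q c : k) : Prop where
  q_ne : q ≠ 0
  rel : v * u = q • (u * v) + c • (u * u)
  indep : LinearIndependent k (fun m : ℕ × ℕ => u ^ m.1 * v ^ m.2)
  span : ⊤ ≤ Submodule.span k (Set.range fun m : ℕ × ℕ => u ^ m.1 * v ^ m.2)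

/-- The degree-lexicographic key of an exponent. -/
def expKey (m : ℕ × ℕ) : ℕ ×ₗ ℕ := toLex (m.1 + m.2, m.2)

theorem expKey_lt_iff (m n : ℕ × ℕ) :
    expKey m < expKey n ↔ m.1 + m.2 < n.1 + n.2 ∨ (m.1 + m.2 = n.1 + n.2 ∧ m.2 < n.2) := by
  simp [expKey, Prod.Lex.toLex_lt_toLex]

theorem expKey_injective : Function.Injective expKey := by
  intro m n h
  simp only [expKey, EmbeddingLike.apply_eq_iff_eq, Prod.mk.injEq] at h
  ext <;> omega

section Plane

variable {k A : Type*} [Field k] [Ring A] [Algebra k A] (u v : A)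

/-- The ordered monomial with exponent `m`. -/
def planeMon (m : ℕ × ℕ) : A := u ^ m.1 * v ^ m.2

variable (k) in
/-- The span of the ordered monomials smaller than `m`. -/
def lowerSpan (m : ℕ × ℕ) : Submodule k A :=
  Submodule.span k (planeMon u v '' {n | expKey n < expKey m})

/-- `a` has leading exponent `m` and leading coefficient `l`. -/
def IsLead (a : A) (m : ℕ × ℕ) (l : k) : Prop :=
  l ≠ 0 ∧ a - l • planeMon u v m ∈ lowerSpan k u v m

variable {u v}

theorem planeMon_mem_lowerSpan {m n : ℕ × ℕ} (h : expKey m < expKey n) :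
    planeMon u v m ∈ lowerSpan k u v n :=
  Submodule.subset_span ⟨m, h, rfl⟩

theorem lowerSpan_mono {m n : ℕ × ℕ} (h : expKey m ≤ expKey n) :
    lowerSpan k u v m ≤ lowerSpan k u v n :=
  Submodule.span_mono (Set.image_mono fun _ hx => lt_of_lt_of_le hx h)

variable {q c : k}

theorem IsPlane.v_mul_u_pow (P : IsPlane u v q c) (i : ℕ) :
    ∃ r : k, v * u ^ i = q ^ i • (u ^ i * v) + r • u ^ (i + 1) := by
  induction i with
  | zero => exact ⟨0, by simp⟩
  | succ i ih =>
    obtain ⟨r, hr⟩ := ih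
    refine ⟨q ^ i * c + r, ?_⟩
    rw [pow_succ u i, ← mul_assoc, hr, add_mul, smul_mul_assoc, mul_assoc, P.rel]
    simp only [mul_add, smul_add, mul_smul_comm, smul_mul_assoc, smul_smul, add_smul, pow_succ,
      mul_assoc]
    abel

theorem u_pow_mul_planeMon (i : ℕ) (m : ℕ × ℕ) :
    u ^ i * planeMon u v m = planeMon u v (i + m.1, m.2) := by
  simp [planeMon, pow_add, mul_assoc]

theorem planeMon_mul_v_pow (i : ℕ) (m : ℕ × ℕ) :
    planeMon u v m * v ^ i = planeMon u v (m.1, m.2 + i) := by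
  simp [planeMon, pow_add, mul_assoc]

theorem IsPlane.v_mul_planeMon (P : IsPlane u v q c) (m : ℕ × ℕ) :
    ∃ r : k, v * planeMon u v m =
      q ^ m.1 • planeMon u v (m.1, m.2 + 1) + r • planeMon u v (m.1 + 1, m.2) := by
  obtain ⟨r, hr⟩ := P.v_mul_u_pow m.1
  refine ⟨r, ?_⟩
  simp only [planeMon]
  rw [← mul_assoc, hr, add_mul, smul_mul_assoc, smul_mul_assoc, mul_assoc, ← pow_succ']

theorem IsPlane.v_mul_mem_lowerSpan (P : IsPlane u v q c) {m : ℕ × ℕ} {a : A}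
    (ha : a ∈ lowerSpan k u v m) : v * a ∈ lowerSpan k u v (m.1, m.2 + 1) := by
  refine Submodule.span_induction (p := fun x _ => v * x ∈ lowerSpan k u v (m.1, m.2 + 1))
    ?_ (by simp) (fun x y _ _ hx hy => by rw [mul_add]; exact add_mem hx hy)
    (fun r x _ hx => by rw [mul_smul_comm]; exact Submodule.smul_mem _ _ hx) ha
  rintro _ ⟨n, hn, rfl⟩
  obtain ⟨r, hr⟩ := P.v_mul_planeMon n
  have hn' := (expKey_lt_iff _ _).1 hn
  rw [hr]
  refine add_mem (Submodule.smul_mem _ _ (planeMon_mem_lowerSpan ?_))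
    (Submodule.smul_mem _ _ (planeMon_mem_lowerSpan ?_)) <;>
  · rw [expKey_lt_iff]; dsimp only; omega

theorem IsPlane.v_pow_mul_u_pow (P : IsPlane u v q c) (j i : ℕ) :
    v ^ j * u ^ i - q ^ (i * j) • planeMon u v (i, j) ∈ lowerSpan k u v (i, j) := by
  induction j with
  | zero => simp [planeMon]
  | succ j ih =>
    have h1 := P.v_mul_mem_lowerSpan ih
    obtain ⟨r, hr⟩ := P.v_mul_planeMon (i, j)
    rw [mul_sub, mul_smul_comm, hr, ← mul_assoc, ← pow_succ'] at h1
    have h2 : planeMon u v (i + 1, j) ∈ lowerSpan k u v (i, j + 1) :=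
      planeMon_mem_lowerSpan (by rw [expKey_lt_iff]; dsimp only; omega)
    have h3 := add_mem h1 (Submodule.smul_mem _ (q ^ (i * j) * r) h2)
    convert h3 using 1
    simp only [smul_add, smul_smul, mul_add, pow_add, mul_one]
    abel

theorem u_pow_mul_mem_lowerSpan {i : ℕ} {m : ℕ × ℕ} {a : A} (ha : a ∈ lowerSpan k u v m) :
    u ^ i * a ∈ lowerSpan k u v (i + m.1, m.2) := by
  refine Submodule.span_induction (p := fun x _ => u ^ i * x ∈ lowerSpan k u v (i + m.1, m.2))
    ?_ (by simp) (fun x y _ _ hx hy => by rw [mul_add]; exact add_mem hx hy)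
    (fun r x _ hx => by rw [mul_smul_comm]; exact Submodule.smul_mem _ _ hx) ha
  rintro _ ⟨n, hn, rfl⟩
  have hn' := (expKey_lt_iff _ _).1 hn
  rw [u_pow_mul_planeMon]
  refine planeMon_mem_lowerSpan ?_
  rw [expKey_lt_iff]; dsimp only; omega

theorem mul_v_pow_mem_lowerSpan {i : ℕ} {m : ℕ × ℕ} {a : A} (ha : a ∈ lowerSpan k u v m) :
    a * v ^ i ∈ lowerSpan k u v (m.1, m.2 + i) := by
  refine Submodule.span_induction (p := fun x _ => x * v ^ i ∈ lowerSpan k u v (m.1, m.2 + i))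
    ?_ (by simp) (fun x y _ _ hx hy => by rw [add_mul]; exact add_mem hx hy)
    (fun r x _ hx => by rw [smul_mul_assoc]; exact Submodule.smul_mem _ _ hx) ha
  rintro _ ⟨n, hn, rfl⟩
  have hn' := (expKey_lt_iff _ _).1 hn
  rw [planeMon_mul_v_pow]
  refine planeMon_mem_lowerSpan ?_
  rw [expKey_lt_iff]; dsimp only; omega

theorem IsPlane.planeMon_mul_planeMon (P : IsPlane u v q c) (m n : ℕ × ℕ) :
    planeMon u v m * planeMon u v n - q ^ (n.1 * m.2) • planeMon u v (m + n) ∈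
      lowerSpan k u v (m + n) := by
  have h := mul_v_pow_mem_lowerSpan (i := n.2)
    (u_pow_mul_mem_lowerSpan (i := m.1) (P.v_pow_mul_u_pow m.2 n.1))
  rw [mul_sub, sub_mul, mul_smul_comm, u_pow_mul_planeMon, smul_mul_assoc,
    planeMon_mul_v_pow] at h
  have h2 : u ^ m.1 * (v ^ m.2 * u ^ n.1) * v ^ n.2 = planeMon u v m * planeMon u v n := by
    simp only [planeMon, mul_assoc]
  rwa [h2] at h

theorem IsPlane.planeMon_mul_mem (P : IsPlane u v q c) {m n n' : ℕ × ℕ}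
    (h : expKey (m + n) < expKey n') :
    planeMon u v m * planeMon u v n ∈ lowerSpan k u v n' := by
  have h1 := lowerSpan_mono h.le (P.planeMon_mul_planeMon m n)
  have h2 := add_mem h1 (Submodule.smul_mem _ (q ^ (n.1 * m.2))
    (planeMon_mem_lowerSpan (k := k) (u := u) (v := v) h))
  rwa [sub_add_cancel] at h2

theorem IsPlane.planeMon_mul_lower (P : IsPlane u v q c) (m : ℕ × ℕ) {n : ℕ × ℕ} {a : A}
    (ha : a ∈ lowerSpan k u v n) : planeMon u v m * a ∈ lowerSpan k u v (m + n) := by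
  refine Submodule.span_induction (p := fun x _ => planeMon u v m * x ∈ lowerSpan k u v (m + n))
    ?_ (by simp) (fun x y _ _ hx hy => by rw [mul_add]; exact add_mem hx hy)
    (fun r x _ hx => by rw [mul_smul_comm]; exact Submodule.smul_mem _ _ hx) ha
  rintro _ ⟨n', hn, rfl⟩
  have hn' := (expKey_lt_iff _ _).1 hn
  refine P.planeMon_mul_mem ?_
  rw [expKey_lt_iff]; simp only [Prod.fst_add, Prod.snd_add]; omega

theorem IsPlane.lower_mul_planeMon (P : IsPlane u v q c) (n : ℕ × ℕ) {m : ℕ × ℕ} {a : A}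
    (ha : a ∈ lowerSpan k u v m) : a * planeMon u v n ∈ lowerSpan k u v (m + n) := by
  refine Submodule.span_induction (p := fun x _ => x * planeMon u v n ∈ lowerSpan k u v (m + n))
    ?_ (by simp) (fun x y _ _ hx hy => by rw [add_mul]; exact add_mem hx hy)
    (fun r x _ hx => by rw [smul_mul_assoc]; exact Submodule.smul_mem _ _ hx) ha
  rintro _ ⟨n', hn, rfl⟩
  have hn' := (expKey_lt_iff _ _).1 hn
  refine P.planeMon_mul_mem ?_
  rw [expKey_lt_iff]; simp only [Prod.fst_add, Prod.snd_add]; omega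

theorem IsPlane.lower_mul_lower (P : IsPlane u v q c) {m n : ℕ × ℕ} {a b : A}
    (ha : a ∈ lowerSpan k u v m) (hb : b ∈ lowerSpan k u v n) :
    a * b ∈ lowerSpan k u v (m + n) := by
  refine Submodule.span_induction (p := fun x _ => x * b ∈ lowerSpan k u v (m + n))
    ?_ (by simp) (fun x y _ _ hx hy => by rw [add_mul]; exact add_mem hx hy)
    (fun r x _ hx => by rw [smul_mul_assoc]; exact Submodule.smul_mem _ _ hx) ha
  rintro _ ⟨n', hn, rfl⟩
  have hn' := (expKey_lt_iff _ _).1 hn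
  refine lowerSpan_mono ?_ (P.planeMon_mul_lower n' hb)
  refine le_of_lt ?_
  rw [expKey_lt_iff]; simp only [Prod.fst_add, Prod.snd_add]; omega

theorem IsPlane.isLead_mul (P : IsPlane u v q c) {a b : A} {m n : ℕ × ℕ} {l l' : k}
    (ha : IsLead u v a m l) (hb : IsLead u v b n l') :
    IsLead u v (a * b) (m + n) (l * l' * q ^ (n.1 * m.2)) := by
  refine ⟨mul_ne_zero (mul_ne_zero ha.1 hb.1) (pow_ne_zero _ P.q_ne), ?_⟩
  have h1 := P.lower_mul_lower ha.2 hb.2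
  have h2 := Submodule.smul_mem _ l (P.planeMon_mul_lower m hb.2)
  have h3 := Submodule.smul_mem _ l' (P.lower_mul_planeMon n ha.2)
  have h4 := Submodule.smul_mem _ (l * l') (P.planeMon_mul_planeMon m n)
  convert add_mem (add_mem h1 h2) (add_mem h3 h4) using 1
  simp only [mul_sub, sub_mul, smul_sub, mul_smul_comm, smul_mul_assoc, smul_smul]
  rw [mul_comm l' l]
  abel

theorem IsPlane.planeMon_notMem (P : IsPlane u v q c) (m : ℕ × ℕ) :
    planeMon u v m ∉ lowerSpan k u v m :=
  P.indep.notMem_span_image (s := {n | expKey n < expKey m}) (x := m) (by simp)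

theorem IsLead.mem_lower {a : A} {m n : ℕ × ℕ} {l : k}
    (ha : IsLead u v a m l) (h : expKey m < expKey n) : a ∈ lowerSpan k u v n := by
  have h1 := add_mem (lowerSpan_mono h.le ha.2)
    (Submodule.smul_mem _ l (planeMon_mem_lowerSpan (k := k) (u := u) (v := v) h))
  rwa [sub_add_cancel] at h1

theorem IsPlane.isLead_notMem (P : IsPlane u v q c) {a : A} {m : ℕ × ℕ} {l : k}
    (ha : IsLead u v a m l) : a ∉ lowerSpan k u v m := by
  intro h
  have h1 := sub_mem h ha.2
  rw [sub_sub_cancel] at h1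
  exact P.planeMon_notMem m ((Submodule.smul_mem_iff _ ha.1).1 h1)

theorem IsPlane.isLead_unique (P : IsPlane u v q c) {a : A} {m n : ℕ × ℕ} {l l' : k}
    (ha : IsLead u v a m l) (hb : IsLead u v a n l') : m = n ∧ l = l' := by
  have hmn : m = n := by
    rcases lt_trichotomy (expKey m) (expKey n) with h | h | h
    · exact absurd (ha.mem_lower h) (P.isLead_notMem hb)
    · exact expKey_injective h
    · exact absurd (hb.mem_lower h) (P.isLead_notMem ha)
  subst hmn
  refine ⟨rfl, ?_⟩
  by_contra hl
  have h1 := sub_mem hb.2 ha.2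
  rw [sub_sub_sub_cancel_left, ← sub_smul] at h1
  exact P.planeMon_notMem m ((Submodule.smul_mem_iff _ (sub_ne_zero.2 hl)).1 h1)

theorem IsPlane.isLead_ne_zero (P : IsPlane u v q c) {a : A} {m : ℕ × ℕ} {l : k}
    (ha : IsLead u v a m l) : a ≠ 0 := by
  rintro rfl
  exact P.isLead_notMem ha (zero_mem _)

theorem IsPlane.exists_isLead (P : IsPlane u v q c) {a : A} (ha : a ≠ 0) :
    ∃ m, ∃ l : k, IsLead u v a m l := by
  let b := Module.Basis.mk P.indep P.span
  have hb : ∀ m, b m = planeMon u v m := fun m => Module.Basis.mk_apply _ _ _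
  have hs : (b.repr a).support.Nonempty := by
    rw [Finsupp.support_nonempty_iff]; simpa using ha
  obtain ⟨m, hm, hmax⟩ := Finset.exists_max_image _ expKey hs
  refine ⟨m, b.repr a m, by simpa using hm, ?_⟩
  have h1 : a = ∑ i ∈ (b.repr a).support, b.repr a i • planeMon u v i := by
    conv_lhs => rw [← b.linearCombination_repr a]
    simp [Finsupp.linearCombination_apply, Finsupp.sum, hb]
  rw [← Finset.add_sum_erase _ _ hm] at h1
  have h2 : a - b.repr a m • planeMon u v m =
      ∑ i ∈ (b.repr a).support.erase m, b.repr a i • planeMon u v i := by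
    rw [sub_eq_iff_eq_add']; exact h1
  rw [h2]
  refine Submodule.sum_mem _ fun i hi => Submodule.smul_mem _ _ (planeMon_mem_lowerSpan ?_)
  rw [Finset.mem_erase] at hi
  exact lt_of_le_of_ne (hmax i hi.2) fun h => hi.1 (expKey_injective h)

theorem IsPlane.noZeroDivisors (P : IsPlane u v q c) : NoZeroDivisors A where
  eq_zero_or_eq_zero_of_mul_eq_zero := by
    intro a b hab
    by_contra! h
    obtain ⟨m, l, hm⟩ := P.exists_isLead h.1
    obtain ⟨n, l', hn⟩ := P.exists_isLead h.2
    exact P.isLead_ne_zero (P.isLead_mul hm hn) hab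

theorem IsPlane.isLead_planeMon (m : ℕ × ℕ) : IsLead u v (planeMon u v m) m (1 : k) :=
  ⟨one_ne_zero, by simp⟩

theorem IsPlane.nontrivial (P : IsPlane u v q c) : Nontrivial A :=
  ⟨_, 0, P.isLead_ne_zero (IsPlane.isLead_planeMon 0)⟩

theorem IsLead.smul {a : A} {m : ℕ × ℕ} {l r : k} (ha : IsLead u v a m l) (hr : r ≠ 0) :
    IsLead u v (r • a) m (r * l) := by
  refine ⟨mul_ne_zero hr ha.1, ?_⟩
  rw [mul_smul, ← smul_sub]
  exact Submodule.smul_mem _ _ ha.2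

theorem IsPlane.isLead_of_mem (P : IsPlane u v q c) {a : A} {m n : ℕ × ℕ} {l : k}
    (ha : IsLead u v a n l) (h : a ∈ lowerSpan k u v m) : expKey n < expKey m := by
  by_contra! hmn
  exact P.isLead_notMem ha (lowerSpan_mono hmn h)

/-- Division step: if the leading exponent of `c` divides that of `y`, then a multiple of `c`
by a scalar multiple of the quotient monomial cancels the leading term of `y`. -/
theorem IsPlane.exists_sub_mem_lower (P : IsPlane u v q c) {y d : A} {m n : ℕ × ℕ} {l l' : k}
    (hy : IsLead u v y m l) (hd : IsLead u v d n l') (h : n ≤ m) :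
    ∃ r : k, y - (r • planeMon u v (m - n)) * d ∈ lowerSpan k u v m := by
  have h1 := P.isLead_mul (IsPlane.isLead_planeMon (k := k) (u := u) (v := v) (m - n)) hd
  rw [tsub_add_cancel_of_le h] at h1
  set t := 1 * l' * q ^ (n.1 * (m - n).2)
  refine ⟨l * t⁻¹, ?_⟩
  have h2 := h1.smul (mul_ne_zero hy.1 (inv_ne_zero h1.1))
  rw [inv_mul_cancel_right₀ h1.1] at h2
  have h3 := sub_mem hy.2 h2.2
  rwa [sub_sub_sub_cancel_right, ← smul_mul_assoc] at h3

theorem planeMon_map {γ : A →ₐ[k] A} {α β : k} (hu : γ u = α • u) (hv : γ v = β • v)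
    (m : ℕ × ℕ) : γ (planeMon u v m) = (α ^ m.1 * β ^ m.2) • planeMon u v m := by
  simp [planeMon, hu, hv, smul_pow, smul_smul]
  rw [mul_comm]

theorem lowerSpan_map {γ : A →ₐ[k] A} {α β : k} (hu : γ u = α • u) (hv : γ v = β • v)
    {m : ℕ × ℕ} {a : A} (ha : a ∈ lowerSpan k u v m) : γ a ∈ lowerSpan k u v m := by
  refine Submodule.span_induction (p := fun x _ => γ x ∈ lowerSpan k u v m)
    ?_ (by simp) (fun x y _ _ hx hy => by rw [map_add]; exact add_mem hx hy)
    (fun r x _ hx => by rw [map_smul]; exact Submodule.smul_mem _ _ hx) ha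
  rintro _ ⟨n, hn, rfl⟩
  rw [planeMon_map hu hv]
  exact Submodule.smul_mem _ _ (planeMon_mem_lowerSpan hn)

theorem IsPlane.eigenvalue_lead (P : IsPlane u v q c) {γ : A →ₐ[k] A} {α β r : k}
    (hu : γ u = α • u) (hv : γ v = β • v) {a : A} {m : ℕ × ℕ} {l : k} (ha : IsLead u v a m l)
    (h : γ a = r • a) : α ^ m.1 * β ^ m.2 = r := by
  have h1 := lowerSpan_map hu hv ha.2
  rw [map_sub, map_smul, planeMon_map hu hv, h] at h1
  have h2 := sub_mem (Submodule.smul_mem _ r ha.2) h1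
  rw [smul_sub, sub_sub_sub_cancel_left, smul_smul, smul_smul, ← sub_smul, mul_comm r,
    ← mul_sub] at h2
  by_contra hne
  exact P.planeMon_notMem m
    ((Submodule.smul_mem_iff _ (mul_ne_zero ha.1 (sub_ne_zero.2 hne))).1 h2)

open Classical in
variable (k u v) in
/-- The leading exponent of an element (`0` for the zero element). -/
noncomputable def leadExp (a : A) : ℕ × ℕ :=
  if h : ∃ m, ∃ l : k, IsLead u v a m l then h.choose else 0

theorem IsPlane.leadExp_eq (P : IsPlane u v q c) {a : A} {m : ℕ × ℕ} {l : k}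
    (ha : IsLead u v a m l) : leadExp k u v a = m := by
  have h : ∃ m, ∃ l : k, IsLead u v a m l := ⟨m, l, ha⟩
  rw [leadExp, dif_pos h]
  obtain ⟨l', hl'⟩ := h.choose_spec
  exact (P.isLead_unique hl' ha).1

theorem IsPlane.isLead_leadExp (P : IsPlane u v q c) {a : A} (ha : a ≠ 0) :
    ∃ l : k, IsLead u v a (leadExp k u v a) l := by
  obtain ⟨m, l, h⟩ := P.exists_isLead ha
  rw [P.leadExp_eq h]
  exact ⟨l, h⟩

theorem IsPlane.leadExp_mul (P : IsPlane u v q c) {a b : A} (ha : a ≠ 0) (hb : b ≠ 0) :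
    leadExp k u v (a * b) = leadExp k u v a + leadExp k u v b := by
  obtain ⟨l, hl⟩ := P.isLead_leadExp ha
  obtain ⟨l', hl'⟩ := P.isLead_leadExp hb
  exact P.leadExp_eq (P.isLead_mul hl hl')

end Plane

theorem IsGoldieQuotientRing.isUnit_of_ne_zero {S Q : Type*} [Ring S]
    [NoZeroDivisors S] [Ring Q] {f : S →+* Q} (hf : IsGoldieQuotientRing f) {s : S}
    (hs : s ≠ 0) : IsUnit (f s) :=
  hf.isUnit_of_regular s ⟨fun _ _ h => mul_left_cancel₀ hs h, fun _ _ h => mul_right_cancel₀ hs h⟩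

theorem IsGoldieQuotientRing.exists_eq_mul {S Q : Type*} [Ring S] [Nontrivial S]
    [Ring Q] {f : S →+* Q} (hf : IsGoldieQuotientRing f) (x : Q) :
    ∃ y c : S, c ≠ 0 ∧ x * f c = f y := by
  obtain ⟨y, c, hc, h⟩ := hf.right_fraction x
  exact ⟨y, c, hc.ne_zero, h⟩

theorem IsMaximalOrder.of_forall_mem {S Q : Type*} [Ring S] [Ring Q] {f : S →+* Q}
    (h : ∀ R' : Subring Q, f.range ≤ R' → ∀ a b : S, a ≠ 0 → b ≠ 0 →
      (∀ x ∈ R', f a * x * f b ∈ f.range) → ∀ x ∈ R', x ∈ f.range) : IsMaximalOrder f := by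
  rintro ⟨R', hR, a, b, ha, hb, hab⟩
  exact hR.not_ge fun x hx => h R' hR.le a b ha hb hab x hx

section Goldie

variable {S Q : Type*} [Ring S] [NoZeroDivisors S] [Nontrivial S] [Ring Q] {f : S →+* Q}

theorem IsGoldieQuotientRing.ore (hf : IsGoldieQuotientRing f) {p : S} (hp : p ≠ 0) (r : S) :
    ∃ d e : S, d ≠ 0 ∧ r * d = p * e := by
  obtain ⟨w, hw⟩ := hf.isUnit_of_ne_zero hp
  obtain ⟨e, d, hd, h⟩ := hf.exists_eq_mul (↑w⁻¹ * f r)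
  refine ⟨d, e, hd, hf.injective ?_⟩
  rw [map_mul, map_mul, ← h, ← hw, mul_assoc, Units.mul_inv_cancel_left]

/-- An additive degree function takes no smaller value on the numerator than on the denominator
of a fraction all of whose powers have a common denominator. -/
theorem IsGoldieQuotientRing.degree_le (hf : IsGoldieQuotientRing f) (e : S → ℕ)
    (he : ∀ a b, a ≠ 0 → b ≠ 0 → e (a * b) = e a + e b) {x : Q} {y c a b : S}
    (hy : y ≠ 0) (hc : c ≠ 0) (ha : a ≠ 0) (hb : b ≠ 0) (hx : x * f c = f y)
    (h : ∀ m : ℕ, ∃ s, f a * x ^ m * f b = f s) : e c ≤ e y := by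
  have key : ∀ m : ℕ, ∃ y' c' : S, y' ≠ 0 ∧ c' ≠ 0 ∧ x ^ m * f c' = f y' ∧
      e y' + m * e c = e c' + m * e y := by
    intro m
    induction m with
    | zero => exact ⟨1, 1, one_ne_zero, one_ne_zero, by simp, by simp⟩
    | succ m ih =>
      obtain ⟨y', c', hy', hc', h1, h2⟩ := ih
      obtain ⟨d, t, hd, hdt⟩ := hf.ore hc y'
      have ht : t ≠ 0 := by
        rintro rfl
        exact mul_ne_zero hy' hd (by simpa using hdt)
      refine ⟨y * t, c' * d, mul_ne_zero hy ht, mul_ne_zero hc' hd, ?_, ?_⟩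
      · rw [pow_succ', map_mul, mul_assoc, ← mul_assoc (x ^ m), h1, ← map_mul, hdt, map_mul,
          ← mul_assoc, hx, map_mul]
      · have h3 := congrArg e hdt
        rw [he _ _ hy' hd, he _ _ hc ht] at h3
        rw [he _ _ hy ht, he _ _ hc' hd, add_mul, add_mul]
        omega
  by_contra! hlt
  obtain ⟨y', c', hy', hc', h1, h2⟩ := key (e a + e b + 1)
  obtain ⟨s, hs⟩ := h (e a + e b + 1)
  obtain ⟨d, t, hd, hdt⟩ := hf.ore hc' b
  have ht : t ≠ 0 := by
    rintro rfl
    exact mul_ne_zero hb hd (by simpa using hdt)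
  have h4 : s * d = a * y' * t := by
    apply hf.injective
    rw [map_mul, ← hs, mul_assoc, ← map_mul, hdt, map_mul, map_mul, map_mul, mul_assoc (f a),
      ← mul_assoc (x ^ _), h1, mul_assoc]
  have hs0 : s ≠ 0 := by
    rintro rfl
    rw [zero_mul] at h4
    exact mul_ne_zero (mul_ne_zero ha hy') ht h4.symm
  have h5 := congrArg e h4
  have h6 := congrArg e hdt
  rw [he _ _ hs0 hd, he _ _ (mul_ne_zero ha hy') ht, he _ _ ha hy'] at h5
  rw [he _ _ hb hd, he _ _ hc' ht] at h6
  have h7 : (e a + e b + 1) * (e y + 1) ≤ (e a + e b + 1) * e c := Nat.mul_le_mul_left _ hlt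
  rw [mul_add, mul_one] at h7
  omega

/-- A domain with an `ℕ²`-valued leading exponent admitting division steps is a maximal order. -/
theorem IsGoldieQuotientRing.isMaximalOrder_of_exponent (hf : IsGoldieQuotientRing f)
    (e : S → ℕ × ℕ) (he : ∀ a b, a ≠ 0 → b ≠ 0 → e (a * b) = e a + e b)
    (hdiv : ∀ y c, y ≠ 0 → c ≠ 0 → e c ≤ e y →
      ∃ s, y - s * c ≠ 0 → expKey (e (y - s * c)) < expKey (e y)) :
    IsMaximalOrder f := by
  refine IsMaximalOrder.of_forall_mem fun R' hR a b ha hb hab x hx => ?_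
  obtain ⟨y, c, hc, hxc⟩ := hf.exists_eq_mul x
  suffices H : ∀ κ : ℕ ×ₗ ℕ, ∀ y : S, ∀ x ∈ R', expKey (e y) = κ → x * f c = f y → x ∈ f.range from
    H _ y x hx rfl hxc
  intro κ
  induction κ using WellFoundedLT.induction with
  | ind κ ih =>
    intro y x hx hκ hxc
    have hu := hf.isUnit_of_ne_zero hc
    by_cases hy : y = 0
    · rw [hy, map_zero, hu.mul_left_eq_zero] at hxc
      rw [hxc]
      exact zero_mem _
    have hpow : ∀ m : ℕ, ∃ s, f a * x ^ m * f b = f s := fun m =>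
      let ⟨s, hs⟩ := hab _ (pow_mem hx m)
      ⟨s, hs.symm⟩
    have hle : e c ≤ e y :=
      ⟨hf.degree_le (fun s => (e s).1) (fun a b ha hb => by rw [he a b ha hb]; rfl)
        hy hc ha hb hxc hpow,
       hf.degree_le (fun s => (e s).2) (fun a b ha hb => by rw [he a b ha hb]; rfl)
        hy hc ha hb hxc hpow⟩
    obtain ⟨s, hs⟩ := hdiv y c hy hc hle
    have hxs : (x - f s) * f c = f (y - s * c) := by rw [sub_mul, hxc, map_sub, map_mul]
    have hmem : x - f s ∈ f.range := by
      by_cases h0 : y - s * c = 0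
      · rw [h0, map_zero, hu.mul_left_eq_zero] at hxs
        rw [hxs]
        exact zero_mem _
      · exact ih _ (hκ ▸ hs h0) (y - s * c) (x - f s) (sub_mem hx (hR ⟨s, rfl⟩)) rfl hxs
    have := add_mem hmem (⟨s, rfl⟩ : f s ∈ f.range)
    rwa [sub_add_cancel] at this

end Goldie

/-- The fixed ring of a diagonal automorphism of a plane is a maximal order. -/
theorem IsPlane.isMaximalOrder_diagonal {k A : Type*} [Field k] [Ring A] [Algebra k A] {u v : A}
    {q c : k} (P : IsPlane u v q c) {γ : A →ₐ[k] A} {α β : k} (hu : γ u = α • u)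
    (hv : γ v = β • v) {S : Subring A} (hS : ∀ a, a ∈ S ↔ γ a = a)
    {Q : Type*} [Ring Q] {f : S →+* Q} (hf : IsGoldieQuotientRing f) : IsMaximalOrder f := by
  have := P.noZeroDivisors
  have := P.nontrivial
  refine hf.isMaximalOrder_of_exponent (fun s => leadExp k u v (s : A)) ?_ ?_
  · intro a b ha hb
    exact P.leadExp_mul (by simpa using ha) (by simpa using hb)
  · intro y d hy hd hle
    obtain ⟨l, hl⟩ := P.isLead_leadExp (a := (y : A)) (by simpa using hy)
    obtain ⟨l', hl'⟩ := P.isLead_leadExp (a := (d : A)) (by simpa using hd)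
    set m := leadExp k u v (y : A)
    set n := leadExp k u v (d : A)
    obtain ⟨r, hr⟩ := P.exists_sub_mem_lower hl hl' hle
    have h1 := P.eigenvalue_lead hu hv hl (r := 1) (by rw [one_smul, ← hS]; exact y.2)
    have h2 := P.eigenvalue_lead hu hv hl' (r := 1) (by rw [one_smul, ← hS]; exact d.2)
    have h3 : α ^ (m - n).1 * β ^ (m - n).2 = 1 := by
      have h4 : m = (m - n) + n := (tsub_add_cancel_of_le hle).symm
      rw [h4, Prod.fst_add, Prod.snd_add, pow_add, pow_add, mul_mul_mul_comm, h2, mul_one] at h1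
      exact h1
    have hs : r • planeMon u v (m - n) ∈ S := by
      rw [hS, map_smul, planeMon_map hu hv, h3, one_smul]
    refine ⟨⟨_, hs⟩, fun hne => ?_⟩
    have hne' : (y : A) - (r • planeMon u v (m - n)) * (d : A) ≠ 0 := fun h =>
      hne (Subtype.ext (by simpa using h))
    obtain ⟨l'', hl''⟩ := P.isLead_leadExp hne'
    exact P.isLead_of_mem hl'' hr

section Representation

variable {k : Type*} [Field k]

variable (k) in
/-- The action of `u` on ordered monomials. -/
noncomputable def repU : Module.End k (ℕ × ℕ →₀ k) :=
  Finsupp.linearCombination k fun m => Finsupp.single (m.1 + 1, m.2) 1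

/-- The action of `v` on ordered monomials. -/
noncomputable def repV (q c : k) : Module.End k (ℕ × ℕ →₀ k) :=
  Finsupp.linearCombination k fun m => Finsupp.single (m.1, m.2 + 1) (q ^ m.1) +
    Finsupp.single (m.1 + 1, m.2) (c * ∑ t ∈ Finset.range m.1, q ^ t)

theorem repU_single (m : ℕ × ℕ) (r : k) :
    repU k (Finsupp.single m r) = Finsupp.single (m.1 + 1, m.2) r := by
  simp [repU]

theorem repV_single (q c : k) (m : ℕ × ℕ) (r : k) :
    repV q c (Finsupp.single m r) = Finsupp.single (m.1, m.2 + 1) (r * q ^ m.1) +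
      Finsupp.single (m.1 + 1, m.2) (r * (c * ∑ t ∈ Finset.range m.1, q ^ t)) := by
  rw [repV, Finsupp.linearCombination_single, smul_add, Finsupp.smul_single, Finsupp.smul_single,
    smul_eq_mul, smul_eq_mul]

theorem repV_mul_repU (q c : k) :
    repV q c * repU k = q • (repU k * repV q c) + c • (repU k * repU k) := by
  refine Finsupp.lhom_ext fun m r => ?_
  simp only [Module.End.mul_apply, LinearMap.add_apply, LinearMap.smul_apply, repU_single,
    repV_single, map_add, smul_add, Finsupp.smul_single, smul_eq_mul, add_assoc,
    ← Finsupp.single_add]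
  congr 2
  · ring
  · simp only [Finset.sum_range_succ', pow_succ, ← Finset.sum_mul]
    ring

theorem repU_pow_single (i : ℕ) (m : ℕ × ℕ) (r : k) :
    (repU k ^ i) (Finsupp.single m r) = Finsupp.single (m.1 + i, m.2) r := by
  induction i with
  | zero => simp
  | succ i ih => rw [pow_succ', Module.End.mul_apply, ih, repU_single, add_assoc]

theorem repV_pow_single (q c : k) (j : ℕ) :
    (repV q c ^ j) (Finsupp.single 0 1) = Finsupp.single (0, j) 1 := by
  induction j with
  | zero => rfl
  | succ j ih => rw [pow_succ', Module.End.mul_apply, ih, repV_single]; simp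

theorem IsPlane.of_representation {A : Type*} [Ring A] [Algebra k A] {u v : A} {q c : k}
    (hq : q ≠ 0) (hrel : v * u = q • (u * v) + c • (u * u))
    (hgen : Algebra.adjoin k {u, v} = ⊤) (ρ : A →ₐ[k] Module.End k (ℕ × ℕ →₀ k))
    (hu : ρ u = repU k) (hv : ρ v = repV q c) : IsPlane u v q c := by
  have hind : LinearIndependent k (fun m : ℕ × ℕ => u ^ m.1 * v ^ m.2) := by
    let F : A →ₗ[k] (ℕ × ℕ →₀ k) := (LinearMap.applyₗ (Finsupp.single 0 1)).comp ρ.toLinearMap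
    refine LinearIndependent.of_comp F ?_
    have hF : F ∘ (fun m : ℕ × ℕ => u ^ m.1 * v ^ m.2) = fun m => Finsupp.single m 1 := by
      funext m
      simp [F, hu, hv, repV_pow_single, repU_pow_single]
    rw [hF]
    exact Finsupp.linearIndependent_single_one k _
  set W := Submodule.span k (Set.range fun m : ℕ × ℕ => u ^ m.1 * v ^ m.2) with hW
  have hmon : ∀ i j, u ^ i * v ^ j ∈ W := fun i j => Submodule.subset_span ⟨(i, j), rfl⟩
  have hleft : ∀ a ∈ W, u * a ∈ W := by
    intro a ha
    refine Submodule.span_induction (p := fun x _ => u * x ∈ W) ?_ (by simp)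
      (fun x y _ _ hx hy => by rw [mul_add]; exact add_mem hx hy)
      (fun r x _ hx => by rw [mul_smul_comm]; exact Submodule.smul_mem _ _ hx) ha
    rintro _ ⟨m, rfl⟩
    dsimp only
    rw [← mul_assoc, ← pow_succ']
    exact hmon _ _
  have hpow : ∀ i j, v * (u ^ i * v ^ j) ∈ W := by
    intro i
    induction i with
    | zero => intro j; simpa [pow_succ'] using hmon 0 (j + 1)
    | succ i ih =>
      intro j
      have h1 : v * (u ^ (i + 1) * v ^ j) =
          q • (u * (v * (u ^ i * v ^ j))) + c • (u ^ (i + 2) * v ^ j) := by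
        rw [pow_succ', mul_assoc, ← mul_assoc v, hrel, add_mul, smul_mul_assoc, smul_mul_assoc,
          pow_succ', pow_succ']
        simp only [mul_assoc]
      rw [h1]
      exact add_mem (Submodule.smul_mem _ _ (hleft _ (ih j))) (Submodule.smul_mem _ _ (hmon _ _))
  have hleft' : ∀ a ∈ W, v * a ∈ W := by
    intro a ha
    refine Submodule.span_induction (p := fun x _ => v * x ∈ W) ?_ (by simp)
      (fun x y _ _ hx hy => by rw [mul_add]; exact add_mem hx hy)
      (fun r x _ hx => by rw [mul_smul_comm]; exact Submodule.smul_mem _ _ hx) ha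
    rintro _ ⟨m, rfl⟩
    exact hpow _ _
  refine ⟨hq, hrel, hind, fun a _ => ?_⟩
  have ha : a ∈ Algebra.adjoin k {u, v} := hgen ▸ Algebra.mem_top
  suffices h : ∀ w ∈ W, a * w ∈ W by
    simpa using h 1 (by simpa using hmon 0 0)
  refine Algebra.adjoin_induction (p := fun x _ => ∀ w ∈ W, x * w ∈ W) ?_ ?_ ?_ ?_ ha
  · rintro x (rfl | rfl) w hw
    · exact hleft w hw
    · exact hleft' w hw
  · intro r w hw
    rw [← Algebra.smul_def]
    exact Submodule.smul_mem _ _ hw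
  · intro x y _ _ hx hy w hw
    rw [add_mul]
    exact add_mem (hx w hw) (hy w hw)
  · intro x y _ _ hx hy w hw
    rw [mul_assoc]
    exact hx _ (hy w hw)

theorem adjoin_mkAlgHom_eq_top (r : FreeAlgebra k (Fin 2) → FreeAlgebra k (Fin 2) → Prop) :
    Algebra.adjoin k {RingQuot.mkAlgHom k r (FreeAlgebra.ι k 0),
      RingQuot.mkAlgHom k r (FreeAlgebra.ι k 1)} = ⊤ := by
  have h := congrArg (Subalgebra.map (RingQuot.mkAlgHom k r)) (FreeAlgebra.adjoin_range_ι k (Fin 2))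
  rw [AlgHom.map_adjoin, Algebra.map_top,
    (AlgHom.range_eq_top _).2 (RingQuot.mkAlgHom_surjective k r)] at h
  rw [← h]
  congr 1
  ext x
  simp [eq_comm]

theorem qV_mul_qU (q : k) : qV k q * qU k q = q • (qU k q * qV k q) := by
  have h := RingQuot.mkAlgHom_rel k (QuantumRel.rel (K := k) (q := q))
  rwa [map_mul, map_smul, map_mul] at h

theorem jV_mul_jU : jV k * jU k = jU k * jV k + jU k * jU k := by
  have h := RingQuot.mkAlgHom_rel k (JordanRel.rel (K := k))
  rwa [map_mul, map_add, map_mul, map_mul] at h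

/-- The universal property of the quantum plane. -/
noncomputable def quantumLift {B : Type*} [Ring B] [Algebra k B] {q : k} (U V : B)
    (h : V * U = q • (U * V)) : QuantumPlane k q →ₐ[k] B :=
  RingQuot.liftAlgHom k ⟨FreeAlgebra.lift k ![U, V], by
    rintro _ _ ⟨⟩
    simpa using h⟩

theorem quantumLift_qU {B : Type*} [Ring B] [Algebra k B] {q : k} (U V : B)
    (h : V * U = q • (U * V)) : quantumLift U V h (qU k q) = U := by
  simp [quantumLift, qU]

theorem quantumLift_qV {B : Type*} [Ring B] [Algebra k B] {q : k} (U V : B)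
    (h : V * U = q • (U * V)) : quantumLift U V h (qV k q) = V := by
  simp [quantumLift, qV]

theorem isPlane_quantumPlane {q : k} (hq : q ≠ 0) : IsPlane (qU k q) (qV k q) q (0 : k) :=
  IsPlane.of_representation hq (by rw [zero_smul, add_zero, qV_mul_qU])
    (adjoin_mkAlgHom_eq_top _)
    (quantumLift (repU k) (repV q 0) (by rw [repV_mul_repU, zero_smul, add_zero]))
    (quantumLift_qU _ _ _) (quantumLift_qV _ _ _)

theorem isPlane_jordanPlane : IsPlane (jU k) (jV k) (1 : k) (1 : k) := by
  have h : ∀ ⦃x y : FreeAlgebra k (Fin 2)⦄, JordanRel k x y →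
      FreeAlgebra.lift k ![repU k, repV 1 1] x = FreeAlgebra.lift k ![repU k, repV 1 1] y := by
    rintro _ _ ⟨⟩
    simpa using repV_mul_repU (1 : k) 1
  refine IsPlane.of_representation one_ne_zero (by rw [one_smul, one_smul, jV_mul_jU])
    (adjoin_mkAlgHom_eq_top _) (RingQuot.liftAlgHom k ⟨_, h⟩) ?_ ?_
  · simp [jU]
  · simp [jV]

end Representation

section SkewPlane

variable {k : Type*} [Field k]

variable (k) in
/-- The `(-1)`-quantum plane. -/
def SkewPlane := QuantumPlane k (-1 : k)

noncomputable instance : Ring (SkewPlane k) :=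
  inferInstanceAs (Ring (QuantumPlane k (-1 : k)))

noncomputable instance : Algebra k (SkewPlane k) :=
  inferInstanceAs (Algebra k (QuantumPlane k (-1 : k)))

variable (k) in
/-- The generator `u` of the `(-1)`-quantum plane. -/
noncomputable def skU : SkewPlane k := qU k (-1 : k)

variable (k) in
/-- The generator `v` of the `(-1)`-quantum plane. -/
noncomputable def skV : SkewPlane k := qV k (-1 : k)

variable (k) in
theorem isPlane_skewPlane : IsPlane (skU k) (skV k) (-1 : k) (0 : k) :=
  isPlane_quantumPlane (neg_ne_zero.2 one_ne_zero)

/-- The universal property of the `(-1)`-quantum plane. -/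
noncomputable def skLift {B : Type*} [Ring B] [Algebra k B] (U V : B) (h : V * U = -(U * V)) :
    SkewPlane k →ₐ[k] B :=
  quantumLift (q := (-1 : k)) U V (by rw [h, neg_one_smul])

theorem skLift_skU {B : Type*} [Ring B] [Algebra k B] (U V : B) (h : V * U = -(U * V)) :
    skLift (k := k) U V h (skU k) = U :=
  quantumLift_qU _ _ _

theorem skLift_skV {B : Type*} [Ring B] [Algebra k B] (U V : B) (h : V * U = -(U * V)) :
    skLift (k := k) U V h (skV k) = V :=
  quantumLift_qV _ _ _

instance : NoZeroDivisors (SkewPlane k) := (isPlane_skewPlane k).noZeroDivisors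

instance : Nontrivial (SkewPlane k) := (isPlane_skewPlane k).nontrivial

/-- The ordered monomials of the `(-1)`-quantum plane. -/
noncomputable abbrev skMon (k : Type*) [Field k] (m : ℕ × ℕ) : SkewPlane k :=
  planeMon (skU k) (skV k) m

theorem skV_mul_skU : skV k * skU k = -(skU k * skV k) := by
  have h := (isPlane_skewPlane k).rel
  rwa [neg_one_smul, zero_smul, add_zero] at h

theorem skV_pow_mul_skU_pow (j i : ℕ) :
    skV k ^ j * skU k ^ i = (-1 : k) ^ (i * j) • (skU k ^ i * skV k ^ j) := by
  have h1 : ∀ i, skV k * skU k ^ i = (-1 : k) ^ i • (skU k ^ i * skV k) := by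
    intro i
    induction i with
    | zero => simp
    | succ i ih =>
      rw [pow_succ (skU k), ← mul_assoc, ih, smul_mul_assoc, mul_assoc, skV_mul_skU, pow_succ,
        mul_neg, mul_neg_one, neg_smul, smul_neg, mul_assoc]
  induction j with
  | zero => simp
  | succ j ih =>
    rw [pow_succ' (skV k), mul_assoc, ih, mul_smul_comm, ← mul_assoc, h1, smul_mul_assoc, smul_smul,
      mul_assoc, ← pow_add, mul_add_one]

theorem skMon_mul_skMon (m n : ℕ × ℕ) :
    skMon k m * skMon k n = (-1 : k) ^ (n.1 * m.2) • skMon k (m + n) := by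
  have h : skMon k m * skMon k n =
      skU k ^ m.1 * (skV k ^ m.2 * skU k ^ n.1) * skV k ^ n.2 := by
    simp only [planeMon, mul_assoc]
  rw [h, skV_pow_mul_skU_pow]
  simp only [planeMon, mul_smul_comm, smul_mul_assoc, Prod.fst_add, Prod.snd_add, pow_add,
    mul_assoc]

theorem skewPlane_induction {p : SkewPlane k → Prop} (hmon : ∀ m, p (skMon k m))
    (hadd : ∀ a b, p a → p b → p (a + b)) (hsmul : ∀ (r : k) a, p a → p (r • a)) (a : SkewPlane k) :
    p a := by
  have h : a ∈ Submodule.span k (Set.range (skMon k)) :=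
    (isPlane_skewPlane k).span (Submodule.mem_top (x := a))
  refine Submodule.span_induction (p := fun x _ => p x) ?_ ?_ (fun x y _ _ => hadd x y)
    (fun r x _ => hsmul r x) h
  · rintro _ ⟨m, rfl⟩
    exact hmon m
  · simpa using hsmul 0 _ (hmon 0)

theorem skewPlane_algHom_ext {B : Type*} [Ring B] [Algebra k B] {φ ψ : SkewPlane k →ₐ[k] B}
    (hu : φ (skU k) = ψ (skU k)) (hv : φ (skV k) = ψ (skV k)) : φ = ψ := by
  refine AlgHom.ext fun a => ?_
  refine skewPlane_induction (p := fun a => φ a = ψ a) (fun m => ?_) (fun a b ha hb => ?_)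
    (fun r a ha => ?_) a
  · simp only [planeMon, map_mul, map_pow, hu, hv]
  · simp only [map_add, ha, hb]
  · simp only [map_smul, ha]

/-- Elements fixed by a linear map acting on monomials by signs. -/
theorem mem_span_of_sign [CharZero k] (σ : SkewPlane k →ₗ[k] SkewPlane k) (s : ℕ × ℕ → ℕ)
    (hσ : ∀ m, σ (skMon k m) = (-1 : k) ^ s m • skMon k m) {a : SkewPlane k} (ha : σ a = a) :
    a ∈ Submodule.span k (skMon k '' {m | Even (s m)}) := by
  have h : ∀ a, a + σ a ∈ Submodule.span k (skMon k '' {m | Even (s m)}) := by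
    refine skewPlane_induction (fun m => ?_) (fun a b ha hb => ?_) (fun r a ha => ?_)
    · rw [hσ]
      by_cases hm : Even (s m)
      · rw [hm.neg_one_pow, one_smul]
        have := Submodule.subset_span (R := k)
          (Set.mem_image_of_mem (skMon k) (show m ∈ {m | Even (s m)} from hm))
        exact add_mem this this
      · rw [(Nat.not_even_iff_odd.1 hm).neg_one_pow, neg_one_smul, add_neg_cancel]
        exact zero_mem _
    · rw [map_add, add_add_add_comm]
      exact add_mem ha hb
    · rw [map_smul, ← smul_add]
      exact Submodule.smul_mem _ _ ha
  have h1 := h a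
  rw [ha, ← two_smul k, Submodule.smul_mem_iff _ two_ne_zero] at h1
  exact h1

variable (k) in
/-- The automorphism negating both generators. -/
noncomputable def skParity : SkewPlane k →ₐ[k] SkewPlane k :=
  skLift (-skU k) (-skV k) (by rw [neg_mul_neg, neg_mul_neg, skV_mul_skU])

theorem skParity_skU : skParity k (skU k) = (-1 : k) • skU k := by
  rw [skParity, skLift_skU, neg_one_smul]

theorem skParity_skV : skParity k (skV k) = (-1 : k) • skV k := by
  rw [skParity, skLift_skV, neg_one_smul]

theorem skParity_skMon (m : ℕ × ℕ) :
    skParity k (skMon k m) = (-1 : k) ^ (m.1 + m.2) • skMon k m := by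
  rw [planeMon_map skParity_skU skParity_skV, pow_add]

theorem commute_of_mem_span {s t : Set (ℕ × ℕ)}
    (h : ∀ m ∈ s, ∀ n ∈ t, Commute (skMon k m) (skMon k n)) {a b : SkewPlane k}
    (ha : a ∈ Submodule.span k (skMon k '' s)) (hb : b ∈ Submodule.span k (skMon k '' t)) :
    Commute a b := by
  refine Submodule.span_induction (p := fun x _ => Commute x b) ?_ (Commute.zero_left _)
    (fun x y _ _ hx hy => hx.add_left hy) (fun r x _ hx => hx.smul_left r) ha
  rintro _ ⟨m, hm, rfl⟩
  refine Submodule.span_induction (p := fun x _ => Commute (skMon k m) x) ?_ (Commute.zero_right _)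
    (fun x y _ _ hx hy => hx.add_right hy) (fun r x _ hx => hx.smul_right r) hb
  rintro _ ⟨n, hn, rfl⟩
  exact h m hm n hn

theorem commute_skMon {m n : ℕ × ℕ} (h : Even (n.1 * m.2) ↔ Even (m.1 * n.2)) :
    Commute (skMon k m) (skMon k n) := by
  rw [Commute, SemiconjBy, skMon_mul_skMon, skMon_mul_skMon, neg_one_pow_congr h, add_comm]

theorem commute_of_skParity_eq [CharZero k] {a b : SkewPlane k} (ha : skParity k a = a)
    (hb : skParity k b = b) : Commute a b := by
  refine commute_of_mem_span ?_ (mem_span_of_sign (skParity k).toLinearMap _ skParity_skMon ha)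
    (mem_span_of_sign (skParity k).toLinearMap _ skParity_skMon hb)
  intro m hm n hn
  refine commute_skMon ?_
  simp only [Set.mem_ofPred_eq, Nat.even_add, Nat.even_mul] at hm hn ⊢
  tauto

variable (k) in
/-- The span of the monomials in `u²` and `v²`. -/
noncomputable def evenSpan : Submodule k (SkewPlane k) :=
  Submodule.span k (skMon k '' {m | Even m.1 ∧ Even m.2})

theorem commute_of_mem_evenSpan {c : SkewPlane k} (hc : c ∈ evenSpan k) (b : SkewPlane k) :
    Commute c b := by
  refine commute_of_mem_span (t := Set.univ) ?_ hc ?_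
  · rintro m ⟨h1, h2⟩ n -
    refine commute_skMon ?_
    simp only [Nat.even_mul]
    tauto
  · rw [Set.image_univ]
    exact (isPlane_skewPlane k).span Submodule.mem_top

theorem skParity_of_mem_evenSpan {c : SkewPlane k} (hc : c ∈ evenSpan k) : skParity k c = c := by
  refine Submodule.span_induction (p := fun x _ => skParity k x = x) ?_ (map_zero _)
    (fun x y _ _ hx hy => by rw [map_add, hx, hy]) (fun r x _ hx => by rw [map_smul, hx]) hc
  rintro _ ⟨m, ⟨h1, h2⟩, rfl⟩
  rw [skParity_skMon, (h1.add h2).neg_one_pow, one_smul]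

open MulOpposite in
variable (k) in
/-- The anti-automorphism negating both generators, valued in the opposite ring. -/
noncomputable def skConjOp : SkewPlane k →ₐ[k] (SkewPlane k)ᵐᵒᵖ :=
  skLift (op (-skU k)) (op (-skV k)) (by
    rw [← op_mul, ← op_mul, ← op_neg, neg_mul_neg, neg_mul_neg, skV_mul_skU, neg_neg])

/-- The anti-automorphism negating both generators. -/
noncomputable def skConj (a : SkewPlane k) : SkewPlane k := (skConjOp k a).unop

theorem skConj_mul (a b : SkewPlane k) : skConj (a * b) = skConj b * skConj a := by
  simp [skConj]

variable (k) in
/-- The anti-automorphism negating both generators, as a linear map. -/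
noncomputable def skConjLin : SkewPlane k →ₗ[k] SkewPlane k :=
  (MulOpposite.opLinearEquiv k).symm.toLinearMap.comp (skConjOp k).toLinearMap

theorem skConjLin_apply (a : SkewPlane k) : skConjLin k a = skConj a := rfl

theorem skConj_skU : skConj (skU k) = -skU k := by
  rw [skConj, skConjOp, skLift_skU, MulOpposite.unop_op]

theorem skConj_skV : skConj (skV k) = -skV k := by
  rw [skConj, skConjOp, skLift_skV, MulOpposite.unop_op]

theorem skConj_skMon (m : ℕ × ℕ) :
    skConj (skMon k m) = (-1 : k) ^ (m.1 + m.2 + m.1 * m.2) • skMon k m := by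
  have hpow : ∀ (a : SkewPlane k) (i : ℕ), skConj (a ^ i) = skConj a ^ i := fun a i => by
    simp [skConj]
  simp only [planeMon]
  rw [skConj_mul, hpow, hpow, skConj_skU, skConj_skV, ← neg_one_smul k (skU k),
    ← neg_one_smul k (skV k), smul_pow, smul_pow, smul_mul_smul_comm,
    skV_pow_mul_skU_pow, smul_smul]
  congr 1
  ring

theorem skConj_skConj (a : SkewPlane k) : skConj (skConj a) = a := by
  rw [← skConjLin_apply, ← skConjLin_apply]
  refine skewPlane_induction (p := fun a => skConjLin k (skConjLin k a) = a)
    (fun m => ?_) (fun a b ha hb => ?_) (fun r a ha => ?_) a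
  · rw [skConjLin_apply (skMon k m), skConj_skMon, map_smul, skConjLin_apply, skConj_skMon,
      smul_smul, ← pow_add, Even.neg_one_pow ⟨_, rfl⟩, one_smul]
  · rw [map_add, map_add, ha, hb]
  · rw [map_smul, map_smul, ha]

theorem skConj_ne_zero {a : SkewPlane k} (ha : a ≠ 0) : skConj a ≠ 0 := by
  intro h
  apply ha
  rw [← skConj_skConj a, h, ← skConjLin_apply, map_zero]

theorem mul_skConj_mem [CharZero k] (a : SkewPlane k) : a * skConj a ∈ evenSpan k := by
  have h := mem_span_of_sign (skConjLin k) _ (fun m => skConj_skMon m) (a := a * skConj a)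
    (by rw [skConjLin_apply, skConj_mul, skConj_skConj])
  refine Submodule.span_mono (Set.image_mono ?_) h
  intro m hm
  simp only [Set.mem_ofPred_eq, Nat.even_add, Nat.even_mul] at hm ⊢
  tauto

theorem skConj_map (δ : SkewPlane k →ₐ[k] SkewPlane k) (hu : skConj (δ (skU k)) = -δ (skU k))
    (hv : skConj (δ (skV k)) = -δ (skV k)) (a : SkewPlane k) :
    skConj (δ a) = δ (skConj a) := by
  have h : (skConjOp k).comp δ = (AlgHom.op δ).comp (skConjOp k) := by
    refine skewPlane_algHom_ext ?_ ?_
    · apply MulOpposite.unop_injective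
      refine hu.trans ?_
      simp [skConjOp, skLift_skU]
    · apply MulOpposite.unop_injective
      refine hv.trans ?_
      simp [skConjOp, skLift_skV]
  exact congrArg MulOpposite.unop (DFunLike.congr_fun h a)

end SkewPlane

section Grading

variable {k : Type*} [Field k]

open Polynomial

variable (k) in
/-- The homomorphism into polynomials recording the total degree. -/
noncomputable def skGrade : SkewPlane k →ₐ[k] (SkewPlane k)[X] :=
  skLift (monomial 1 (skU k)) (monomial 1 (skV k)) (by
    rw [monomial_mul_monomial, monomial_mul_monomial, skV_mul_skU, map_neg])

theorem skGrade_skU : skGrade k (skU k) = monomial 1 (skU k) := skLift_skU _ _ _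

theorem skGrade_skV : skGrade k (skV k) = monomial 1 (skV k) := skLift_skV _ _ _

theorem skGrade_skMon (m : ℕ × ℕ) :
    skGrade k (skMon k m) = monomial (m.1 + m.2) (skMon k m) := by
  simp only [planeMon, map_mul, map_pow, skGrade_skU, skGrade_skV, monomial_pow,
    monomial_mul_monomial, one_mul]

theorem eval_one_skGrade (a : SkewPlane k) : (skGrade k a).eval 1 = a := by
  refine skewPlane_induction (p := fun a => (skGrade k a).eval 1 = a) (fun m => ?_)
    (fun a b ha hb => ?_) (fun r a ha => ?_) a
  · rw [skGrade_skMon, eval_monomial, one_pow, mul_one]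
  · rw [map_add, eval_add, ha, hb]
  · rw [map_smul, eval_smul, ha]

theorem skGrade_injective : Function.Injective (skGrade k) :=
  Function.LeftInverse.injective (g := eval 1) eval_one_skGrade

theorem skGrade_coeff (a : SkewPlane k) (d : ℕ) :
    skGrade k ((skGrade k a).coeff d) = monomial d ((skGrade k a).coeff d) := by
  refine skewPlane_induction (p := fun a => skGrade k ((skGrade k a).coeff d) =
    monomial d ((skGrade k a).coeff d)) (fun m => ?_) (fun a b ha hb => ?_) (fun r a ha => ?_) a
  · rw [skGrade_skMon, coeff_monomial]
    split_ifs with h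
    · rw [skGrade_skMon, h]
    · simp
  · rw [map_add, coeff_add, map_add, map_add, ha, hb]
  · rw [map_smul, coeff_smul, map_smul, ha, smul_monomial]

theorem skParity_coeff (a : SkewPlane k) (d : ℕ) :
    skParity k ((skGrade k a).coeff d) = (-1 : k) ^ d • (skGrade k a).coeff d := by
  refine skewPlane_induction (p := fun a => skParity k ((skGrade k a).coeff d) =
    (-1 : k) ^ d • (skGrade k a).coeff d) (fun m => ?_) (fun a b ha hb => ?_) (fun r a ha => ?_) a
  · rw [skGrade_skMon, coeff_monomial]
    split_ifs with h
    · rw [skParity_skMon, h]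
    · simp
  · rw [map_add, coeff_add, map_add, smul_add, ha, hb]
  · rw [map_smul, coeff_smul, map_smul, ha, smul_comm]

theorem coeff_skGrade_mem_evenSpan {c : SkewPlane k} (hc : c ∈ evenSpan k) (d : ℕ) :
    (skGrade k c).coeff d ∈ evenSpan k := by
  refine Submodule.span_induction (p := fun x _ => (skGrade k x).coeff d ∈ evenSpan k) ?_
    (by simp) (fun x y _ _ hx hy => by rw [map_add, coeff_add]; exact add_mem hx hy)
    (fun r x _ hx => by rw [map_smul, coeff_smul]; exact Submodule.smul_mem _ _ hx) hc
  rintro _ ⟨m, hm, rfl⟩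
  rw [skGrade_skMon, coeff_monomial]
  split_ifs with h
  · exact Submodule.subset_span ⟨m, hm, rfl⟩
  · exact zero_mem _

theorem coeff_skGrade_map {δ : SkewPlane k →ₐ[k] SkewPlane k}
    (hu : skGrade k (δ (skU k)) = monomial 1 (δ (skU k)))
    (hv : skGrade k (δ (skV k)) = monomial 1 (δ (skV k))) (a : SkewPlane k) (d : ℕ) :
    (skGrade k (δ a)).coeff d = δ ((skGrade k a).coeff d) := by
  refine skewPlane_induction (p := fun a => (skGrade k (δ a)).coeff d =
    δ ((skGrade k a).coeff d)) (fun m => ?_) (fun a b ha hb => ?_) (fun r a ha => ?_) a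
  · rw [skGrade_skMon]
    simp only [planeMon, map_mul, map_pow, hu, hv, monomial_pow, monomial_mul_monomial, one_mul,
      coeff_monomial]
    split_ifs <;> simp
  · simp only [map_add, coeff_add, ha, hb]
  · simp only [map_smul, coeff_smul, ha]

end Grading

section Closure

variable {k : Type*} [Field k]

theorem leadExp_pow_skew {a : SkewPlane k} (ha : a ≠ 0) (i : ℕ) :
    leadExp k (skU k) (skV k) (a ^ i) = i • leadExp k (skU k) (skV k) a := by
  induction i with
  | zero =>
    rw [pow_zero, zero_smul]
    exact (isPlane_skewPlane k).leadExp_eq (l := (1 : k))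
      (by simpa [planeMon] using
        IsPlane.isLead_planeMon (k := k) (u := skU k) (v := skV k) (0 : ℕ × ℕ))
  | succ i ih =>
    rw [pow_succ, (isPlane_skewPlane k).leadExp_mul (pow_ne_zero _ ha) ha, ih, succ_nsmul]

/-- The degree-even part of the `(-1)`-quantum plane is completely integrally closed. -/
theorem exists_eq_mul_of_forall_pow [CharZero k] {z c : SkewPlane k} (hz : z ≠ 0) (hc0 : c ≠ 0)
    (hc : c ∈ evenSpan k) {y : SkewPlane k} (hy : skParity k y = y)
    (h : ∀ i : ℕ, ∃ s, z * y ^ i = s * c ^ i) : ∃ s, y = s * c := by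
  have P := isPlane_skewPlane k
  suffices H : ∀ κ : ℕ ×ₗ ℕ, ∀ y : SkewPlane k, expKey (leadExp k (skU k) (skV k) y) = κ →
      skParity k y = y → (∀ i : ℕ, ∃ s, z * y ^ i = s * c ^ i) → ∃ s, y = s * c from
    H _ y rfl hy h
  intro κ
  induction κ using WellFoundedLT.induction with
  | ind κ ih =>
  intro y hκ hy h
  by_cases hy0 : y = 0
  · exact ⟨0, by rw [hy0, zero_mul]⟩
  have hle : leadExp k (skU k) (skV k) c ≤ leadExp k (skU k) (skV k) y := by
    have key : ∀ i : ℕ, ∃ e : ℕ × ℕ, leadExp k (skU k) (skV k) z +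
        i • leadExp k (skU k) (skV k) y = e + i • leadExp k (skU k) (skV k) c := by
      intro i
      obtain ⟨s, hs⟩ := h i
      have hs0 : s ≠ 0 := by
        rintro rfl
        rw [zero_mul] at hs
        exact mul_ne_zero hz (pow_ne_zero i hy0) hs
      refine ⟨leadExp k (skU k) (skV k) s, ?_⟩
      rw [← leadExp_pow_skew hy0, ← leadExp_pow_skew hc0, ← P.leadExp_mul hz (pow_ne_zero _ hy0),
        ← P.leadExp_mul hs0 (pow_ne_zero _ hc0), hs]
    have arith : ∀ p q r : ℕ, (∃ e, r + (r + 1) * p = e + (r + 1) * q) → q ≤ p := by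
      rintro p q r ⟨e, he⟩
      by_contra! hlt
      nlinarith
    obtain ⟨e, he⟩ := key ((leadExp k (skU k) (skV k) z).1 + 1)
    obtain ⟨e', he'⟩ := key ((leadExp k (skU k) (skV k) z).2 + 1)
    exact ⟨arith _ _ _ ⟨e.1, congrArg Prod.fst he⟩, arith _ _ _ ⟨e'.2, congrArg Prod.snd he'⟩⟩
  obtain ⟨l, hl⟩ := P.isLead_leadExp hy0
  obtain ⟨l', hl'⟩ := P.isLead_leadExp hc0
  set m := leadExp k (skU k) (skV k) y
  set n := leadExp k (skU k) (skV k) c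
  obtain ⟨r, hr⟩ := P.exists_sub_mem_lower hl hl' hle
  have hcθ := skParity_of_mem_evenSpan hc
  have h1 := P.eigenvalue_lead skParity_skU skParity_skV hl (r := 1) (by rw [one_smul, hy])
  have h2 := P.eigenvalue_lead skParity_skU skParity_skV hl' (r := 1) (by rw [one_smul, hcθ])
  have h3 : (-1 : k) ^ (m - n).1 * (-1) ^ (m - n).2 = 1 := by
    have h4 : m = (m - n) + n := (tsub_add_cancel_of_le hle).symm
    rw [h4, Prod.fst_add, Prod.snd_add, pow_add, pow_add, mul_mul_mul_comm, h2, mul_one] at h1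
    exact h1
  set t := r • planeMon (skU k) (skV k) (m - n) with ht
  have htθ : skParity k t = t := by
    rw [ht, map_smul, planeMon_map skParity_skU skParity_skV, h3, one_smul]
  have hθ : skParity k (y - t * c) = y - t * c := by rw [map_sub, map_mul, hy, htθ, hcθ]
  have hpow : ∀ i : ℕ, ∃ s, z * (y - t * c) ^ i = s * c ^ i := by
    intro i
    choose s hs using h
    have hcomm : Commute y (-t * c) := commute_of_skParity_eq hy
      (by rw [map_mul, map_neg, htθ, hcθ])
    refine ⟨∑ j ∈ Finset.range (i + 1), s j * (-t) ^ (i - j) * (i.choose j : SkewPlane k), ?_⟩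
    rw [sub_eq_add_neg, ← neg_mul, hcomm.add_pow, Finset.mul_sum, Finset.sum_mul]
    refine Finset.sum_congr rfl fun j hj => ?_
    have hj' : i = j + (i - j) := by have := Finset.mem_range.1 hj; omega
    rw [(commute_of_mem_evenSpan hc (-t)).symm.mul_pow, ← mul_assoc, ← mul_assoc, hs]
    conv_rhs => rw [hj', pow_add, ← hj']
    have c1 := (commute_of_mem_evenSpan hc ((-t) ^ (i - j))).pow_left j
    have c2 := ((commute_of_mem_evenSpan hc (i.choose j : SkewPlane k)).pow_left (i - j))
    have c3 := ((commute_of_mem_evenSpan hc (i.choose j : SkewPlane k)).pow_left j)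
    simp only [mul_assoc]
    rw [← mul_assoc (c ^ j) ((-t) ^ (i - j)), c1.eq, mul_assoc ((-t) ^ (i - j)) (c ^ j), c2.eq,
      ← mul_assoc (c ^ j), c3.eq, mul_assoc]
  by_cases h0 : y - t * c = 0
  · exact ⟨t, sub_eq_zero.1 h0⟩
  · obtain ⟨l'', hl''⟩ := P.isLead_leadExp h0
    obtain ⟨s, hs⟩ := ih _ (hκ ▸ P.isLead_of_mem hl'' hr) (y - t * c) rfl hθ hpow
    exact ⟨s + t, by rw [add_mul, ← hs, sub_add_cancel]⟩

end Closure

section Coprime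

variable {k : Type*} [Field k]

open Polynomial

variable (k) in
/-- The quotient by `u`. -/
noncomputable def skModU : SkewPlane k →ₐ[k] k[X] := skLift 0 X (by simp)

variable (k) in
/-- The quotient by `v`. -/
noncomputable def skModV : SkewPlane k →ₐ[k] k[X] := skLift X 0 (by simp)

theorem skModU_skU : skModU k (skU k) = 0 := skLift_skU _ _ _

theorem skModU_skV : skModU k (skV k) = X := skLift_skV _ _ _

theorem skModV_skU : skModV k (skU k) = X := skLift_skU _ _ _

theorem skModV_skV : skModV k (skV k) = 0 := skLift_skV _ _ _

theorem exists_eq_mul_skU {a : SkewPlane k} (ha : skModU k a = 0) : ∃ b, a = b * skU k := by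
  suffices H : ∀ a, ∃ b, a = b * skU k + aeval (skV k) (skModU k a) by
    obtain ⟨b, hb⟩ := H a
    exact ⟨b, by rwa [ha, map_zero, add_zero] at hb⟩
  refine skewPlane_induction ?_ ?_ ?_
  · rintro ⟨_ | i, j⟩
    · refine ⟨0, ?_⟩
      simp [planeMon, skModU_skV]
    · refine ⟨(-1 : k) ^ j • skMon k (i, j), ?_⟩
      have h := skMon_mul_skMon (k := k) (i, j) (1, 0)
      have h1 : skMon k (1, 0) = skU k := by simp [planeMon]
      rw [h1] at h
      rw [smul_mul_assoc, h, smul_smul]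
      simp [planeMon, skModU_skU, ← mul_pow]
  · rintro a b ⟨a', ha⟩ ⟨b', hb⟩
    refine ⟨a' + b', ?_⟩
    conv_lhs => rw [ha, hb]
    rw [map_add, map_add, add_mul, add_add_add_comm]
  · rintro r a ⟨a', ha⟩
    refine ⟨r • a', ?_⟩
    conv_lhs => rw [ha]
    rw [map_smul, map_smul, smul_add, smul_mul_assoc]

theorem exists_eq_mul_skV {a : SkewPlane k} (ha : skModV k a = 0) : ∃ b, a = b * skV k := by
  suffices H : ∀ a, ∃ b, a = b * skV k + aeval (skU k) (skModV k a) by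
    obtain ⟨b, hb⟩ := H a
    exact ⟨b, by rwa [ha, map_zero, add_zero] at hb⟩
  refine skewPlane_induction ?_ ?_ ?_
  · rintro ⟨i, _ | j⟩
    · refine ⟨0, ?_⟩
      simp [planeMon, skModV_skU]
    · refine ⟨skMon k (i, j), ?_⟩
      simp [planeMon, skModV_skV, pow_succ, mul_assoc]
  · rintro a b ⟨a', ha⟩ ⟨b', hb⟩
    refine ⟨a' + b', ?_⟩
    conv_lhs => rw [ha, hb]
    rw [map_add, map_add, add_mul, add_add_add_comm]
  · rintro r a ⟨a', ha⟩
    refine ⟨r • a', ?_⟩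
    conv_lhs => rw [ha]
    rw [map_smul, map_smul, smul_add, smul_mul_assoc]

theorem skU_pow_add_skV_pow_mem (n : ℕ) : skU k ^ (2 * n) + skV k ^ (2 * n) ∈ evenSpan k := by
  have h1 : skU k ^ (2 * n) = skMon k (2 * n, 0) := by simp [planeMon]
  have h2 : skV k ^ (2 * n) = skMon k (0, 2 * n) := by simp [planeMon]
  rw [h1, h2]
  exact add_mem (Submodule.subset_span ⟨_, ⟨even_two_mul n, Even.zero⟩, rfl⟩)
    (Submodule.subset_span ⟨_, ⟨Even.zero, even_two_mul n⟩, rfl⟩)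

theorem skMon_ne_zero (m : ℕ × ℕ) : skMon k m ≠ 0 :=
  (isPlane_skewPlane k).isLead_ne_zero (IsPlane.isLead_planeMon m)

theorem skU_ne_zero : skU k ≠ 0 := by simpa [planeMon] using skMon_ne_zero (k := k) (1, 0)

theorem skV_ne_zero : skV k ≠ 0 := by simpa [planeMon] using skMon_ne_zero (k := k) (0, 1)

theorem exists_eq_mul_skU_pow_mul_skV {n : ℕ} (hn : 0 < n) (i : ℕ) {s t : SkewPlane k}
    (h : s * (skU k ^ (2 * n) + skV k ^ (2 * n)) = t * (skU k ^ i * skV k)) :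
    ∃ b, s = b * (skU k ^ i * skV k) := by
  have hE := commute_of_mem_evenSpan (skU_pow_add_skV_pow_mem (k := k) n)
  set E := skU k ^ (2 * n) + skV k ^ (2 * n) with hEdef
  have hn' : 2 * n ≠ 0 := by omega
  have hU : ∀ i (s t : SkewPlane k), s * E = t * skU k ^ i → ∃ b, s = b * skU k ^ i := by
    intro i
    induction i with
    | zero => exact fun s t _ => ⟨s, by simp⟩
    | succ i ih =>
      intro s t h
      rw [pow_succ, ← mul_assoc] at h
      have h1 := congrArg (skModU k) h
      simp only [hEdef, map_mul, map_add, map_pow, skModU_skU, skModU_skV, zero_pow hn', zero_add,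
        mul_zero, mul_eq_zero, pow_eq_zero_iff hn', X_ne_zero, or_false] at h1
      obtain ⟨b, rfl⟩ := exists_eq_mul_skU h1
      rw [mul_assoc, ← (hE (skU k)).eq, ← mul_assoc] at h
      obtain ⟨b', rfl⟩ := ih b t
        (mul_right_cancel₀ skU_ne_zero h)
      exact ⟨b', by rw [pow_succ, mul_assoc]⟩
  rw [← mul_assoc] at h
  have h1 := congrArg (skModV k) h
  simp only [hEdef, map_mul, map_add, map_pow, skModV_skU, skModV_skV, zero_pow hn', add_zero,
    mul_zero, mul_eq_zero, pow_eq_zero_iff hn', X_ne_zero, or_false] at h1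
  obtain ⟨b, rfl⟩ := exists_eq_mul_skV h1
  rw [mul_assoc, ← (hE (skV k)).eq, ← mul_assoc] at h
  obtain ⟨b', rfl⟩ := hU i b t
    (mul_right_cancel₀ skV_ne_zero h)
  exact ⟨b', by rw [mul_assoc]⟩

end Coprime

section Dihedral

open Polynomial

variable {k : Type*} [Field k]

theorem exists_leadingCoeff_eq_mul [CharZero k] {z c y : SkewPlane k} (hz : z ≠ 0) (hc0 : c ≠ 0)
    (hc : c ∈ evenSpan k) (hy : Even (skGrade k y).natDegree)
    (h : ∀ i : ℕ, ∃ s, z * y ^ i = s * c ^ i) :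
    ∃ s, (skGrade k y).leadingCoeff = s * (skGrade k c).leadingCoeff := by
  have hne : ∀ {a : SkewPlane k}, a ≠ 0 → (skGrade k a).leadingCoeff ≠ 0 := fun ha => by
    rwa [leadingCoeff_ne_zero, map_ne_zero_iff _ skGrade_injective]
  have hpow : ∀ (p : (SkewPlane k)[X]) (i : ℕ), (p ^ i).leadingCoeff = p.leadingCoeff ^ i := by
    intro p i
    induction i with
    | zero => simp
    | succ i ih => rw [pow_succ, pow_succ, leadingCoeff_mul, ih]
  refine exists_eq_mul_of_forall_pow (hne hz) (hne hc0) (coeff_skGrade_mem_evenSpan hc _) ?_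
    fun i => ?_
  · rw [leadingCoeff, skParity_coeff, hy.neg_one_pow, one_smul]
  · obtain ⟨s, hs⟩ := h i
    refine ⟨(skGrade k s).leadingCoeff, ?_⟩
    rw [← hpow, ← hpow, ← leadingCoeff_mul, ← leadingCoeff_mul, ← map_pow, ← map_pow, ← map_mul,
      ← map_mul, hs]

variable (k) in
/-- An invariant of the dihedral group. -/
noncomputable def dihedralSum (n : ℕ) : SkewPlane k := skU k ^ n + skV k ^ n

variable (k) in
/-- An invariant of the dihedral group. -/
noncomputable def dihedralDiff (n : ℕ) : SkewPlane k :=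
  (skU k ^ n - skV k ^ n) * (skU k * skV k)

theorem dihedralSum_mul_self {n : ℕ} (hn : Odd n) :
    dihedralSum k n * dihedralSum k n = skU k ^ (2 * n) + skV k ^ (2 * n) := by
  rw [dihedralSum, mul_add, add_mul, add_mul, skV_pow_mul_skU_pow, (hn.mul hn).neg_one_pow,
    two_mul, pow_add, pow_add, neg_one_smul]
  abel

theorem dihedralSum_mul_add (n : ℕ) :
    dihedralSum k n * (skU k * skV k) + dihedralDiff k n =
      (2 : k) • (skU k ^ (n + 1) * skV k) := by
  rw [dihedralSum, dihedralDiff, ← add_mul, add_add_sub_cancel, ← two_smul k, smul_mul_assoc,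
    ← mul_assoc, pow_succ]

theorem dihedralSum_ne_zero (n : ℕ) (hn : 0 < n) : dihedralSum k n ≠ 0 := by
  intro h
  have h1 := congrArg (skModU k) h
  simp [dihedralSum, skModU_skU, skModU_skV, hn.ne'] at h1

theorem dihedralDiff_ne_zero (n : ℕ) (hn : 0 < n) : dihedralDiff k n ≠ 0 := by
  refine mul_ne_zero (fun h => ?_) (mul_ne_zero skU_ne_zero skV_ne_zero)
  have h1 := congrArg (skModU k) h
  simp [skModU_skU, skModU_skV, hn.ne'] at h1

theorem skGrade_dihedralSum (n : ℕ) :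
    skGrade k (dihedralSum k n) = monomial n (dihedralSum k n) := by
  simp only [dihedralSum, map_add, map_pow, skGrade_skU, skGrade_skV, monomial_pow, one_mul]

theorem skGrade_dihedralDiff (n : ℕ) :
    skGrade k (dihedralDiff k n) = monomial (n + 2) (dihedralDiff k n) := by
  simp only [dihedralDiff, map_sub, map_mul, map_pow, skGrade_skU, skGrade_skV, monomial_pow,
    one_mul, monomial_mul_monomial, sub_mul]

theorem exists_eq_mul_of_dihedral [CharZero k] {n : ℕ} (hn : Odd n) {y c : SkewPlane k}
    (hc0 : c ≠ 0) (hc : c ∈ evenSpan k) (h1 : ∃ s, y * dihedralSum k n = s * c)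
    (h2 : ∃ s, y * dihedralDiff k n = s * c) : ∃ t, y = t * c := by
  obtain ⟨s₁, hs₁⟩ := h1
  obtain ⟨s₂, hs₂⟩ := h2
  have hcc := commute_of_mem_evenSpan hc
  set M := skU k ^ (n + 1) * skV k with hM
  have hM0 : M ≠ 0 := mul_ne_zero (pow_ne_zero _ skU_ne_zero) skV_ne_zero
  set s₃ := (2 : k)⁻¹ • (s₁ * (skU k * skV k) + s₂) with hs₃
  have hyM : y * M = s₃ * c := by
    have h := congrArg (fun a => (2 : k)⁻¹ • (y * a)) (dihedralSum_mul_add (k := k) n)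
    simp only [mul_smul_comm, inv_smul_smul₀ (two_ne_zero (α := k))] at h
    rw [← h, mul_add, hs₂, ← mul_assoc, hs₁, mul_assoc s₁, (hcc _).eq, ← mul_assoc, ← add_mul,
      hs₃, smul_mul_assoc]
  have hE := commute_of_mem_evenSpan (skU_pow_add_skV_pow_mem (k := k) n)
  have hyE : y * (skU k ^ (2 * n) + skV k ^ (2 * n)) = s₁ * dihedralSum k n * c := by
    rw [← dihedralSum_mul_self hn, ← mul_assoc, hs₁, mul_assoc, (hcc _).eq, mul_assoc]
  have key : s₃ * (skU k ^ (2 * n) + skV k ^ (2 * n)) = s₁ * dihedralSum k n * M := by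
    refine mul_right_cancel₀ hc0 ?_
    rw [mul_assoc s₃, ← (hcc _).eq, ← mul_assoc, ← hyM, mul_assoc y, ← (hE M).eq, ← mul_assoc, hyE,
      mul_assoc _ c, (hcc M).eq, mul_assoc _ M]
  obtain ⟨t, ht⟩ := exists_eq_mul_skU_pow_mul_skV hn.pos (n + 1) key
  refine ⟨t, mul_right_cancel₀ hM0 ?_⟩
  rw [hyM, ht, mul_assoc, ← (hcc _).eq, mul_assoc]

/-- A nonzero homogeneous element of odd degree is not fixed by a rotation of even order. -/
theorem odd_of_map_coeff_eq [CharZero k] {n : ℕ} (hn : 0 < n) {ω : k} (hω : IsPrimitiveRoot ω n)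
    {γ : SkewPlane k →ₐ[k] SkewPlane k} (hγu : γ (skU k) = ω • skU k)
    (hγv : γ (skV k) = ω⁻¹ • skV k) {a : SkewPlane k} {d : ℕ} (hd : Odd d)
    (ha : (skGrade k a).coeff d ≠ 0) (h : γ ((skGrade k a).coeff d) = (skGrade k a).coeff d) :
    Odd n := by
  have P := isPlane_skewPlane k
  by_contra hn'
  rw [Nat.not_odd_iff_even] at hn'
  obtain ⟨m, hm⟩ := hn'
  obtain ⟨e, l, hl⟩ := P.exists_isLead ha
  have h1 := P.eigenvalue_lead hγu hγv hl (r := 1) (by rw [one_smul, h])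
  have h2 := P.eigenvalue_lead skParity_skU skParity_skV hl (skParity_coeff a d)
  have h3 : ω ^ m = -1 := (hω.pow hn (by omega : n = m * 2)).eq_neg_one_of_two_right
  have h4 := congrArg (· ^ m) h1
  simp only [mul_pow, one_pow] at h4
  rw [pow_right_comm, pow_right_comm ω⁻¹, inv_pow, h3, inv_neg_one, h2, hd.neg_one_pow] at h4
  exact absurd h4 (by norm_num)

theorem IsGoldieQuotientRing.commute_map {S Q : Type*} [Ring S] [NoZeroDivisors S] [Nontrivial S]
    [Ring Q] {f : S →+* Q} (hf : IsGoldieQuotientRing f) {e : S} (he : ∀ s, Commute e s) (x : Q) :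
    Commute (f e) x := by
  obtain ⟨y, c, hc, h⟩ := hf.exists_eq_mul x
  refine (hf.isUnit_of_ne_zero hc).mul_right_cancel ?_
  rw [mul_assoc, h, ← map_mul, (he y).eq, map_mul, ← h, mul_assoc, mul_assoc, ← map_mul, ← map_mul,
    (he c).eq]

/-- The fixed ring of a dihedral group acting on the `(-1)`-quantum plane is a maximal order. -/
theorem isMaximalOrder_dihedral [CharZero k] {n : ℕ} (hn : 0 < n) {ω : k}
    (hω : IsPrimitiveRoot ω n) {γ η : SkewPlane k →ₐ[k] SkewPlane k}
    (hγu : γ (skU k) = ω • skU k) (hγv : γ (skV k) = ω⁻¹ • skV k)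
    (hηu : η (skU k) = skV k) (hηv : η (skV k) = skU k)
    {S : Subring (SkewPlane k)} (hS : ∀ a, a ∈ S ↔ γ a = a ∧ η a = a)
    {Q : Type*} [Ring Q] {f : S →+* Q} (hf : IsGoldieQuotientRing f) : IsMaximalOrder f := by
  have hωn := hω.pow_eq_one
  have hconj : ∀ a ∈ S, skConj a ∈ S := by
    intro a ha
    rw [hS] at ha ⊢
    have hsmul : ∀ (r : k) (a : SkewPlane k), skConj (r • a) = r • skConj a := fun r a => by
      rw [← skConjLin_apply, map_smul, skConjLin_apply]
    constructor
    · rw [← skConj_map, ha.1]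
      · rw [hγu, hsmul, skConj_skU, smul_neg]
      · rw [hγv, hsmul, skConj_skV, smul_neg]
    · rw [← skConj_map, ha.2]
      · rw [hηu, skConj_skV]
      · rw [hηv, skConj_skU]
  have hsum : dihedralSum k n ∈ S := by
    rw [hS]
    simp [dihedralSum, hγu, hγv, hηu, hηv, _root_.smul_pow, hωn, add_comm]
  have hdiff : dihedralDiff k n ∈ S := by
    have hω0 : ω ≠ 0 := hω.ne_zero hn.ne'
    rw [hS]
    constructor
    · simp [dihedralDiff, hγu, hγv, _root_.smul_pow, hωn, smul_smul, hω0]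
    · simp [dihedralDiff, hηu, hηv, skV_mul_skU, sub_mul]
      abel
  have hγcoeff : ∀ a ∈ S, ∀ d, γ ((skGrade k a).coeff d) = (skGrade k a).coeff d := by
    intro a ha d
    rw [← coeff_skGrade_map, ((hS a).1 ha).1]
    · rw [hγu, map_smul, skGrade_skU, smul_monomial]
    · rw [hγv, map_smul, skGrade_skV, smul_monomial]
  have hηcoeff : ∀ a ∈ S, ∀ d, η ((skGrade k a).coeff d) = (skGrade k a).coeff d := by
    intro a ha d
    rw [← coeff_skGrade_map, ((hS a).1 ha).2]
    · rw [hηu, skGrade_skV]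
    · rw [hηv, skGrade_skU]
  refine IsMaximalOrder.of_forall_mem fun R' hR a b ha hb hab x hx => ?_
  obtain ⟨y₀, c₀, hc₀, hxc₀⟩ := hf.exists_eq_mul x
  let star : S → S := fun s => ⟨skConj (s : SkewPlane k), hconj _ s.2⟩
  have hstar0 : ∀ {s : S}, s ≠ 0 → star s ≠ 0 := fun hs h =>
    skConj_ne_zero (by simpa using hs) (congrArg Subtype.val h)
  have hcomm : ∀ {e : S}, (e : SkewPlane k) ∈ evenSpan k → ∀ s : S, Commute e s := fun he s =>
    Subtype.ext (commute_of_mem_evenSpan he _).eq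
  set c := c₀ * star c₀ with hcdef
  have hc0 : c ≠ 0 := mul_ne_zero hc₀ (hstar0 hc₀)
  have hc0' : (c : SkewPlane k) ≠ 0 := by simpa using hc0
  have hc : (c : SkewPlane k) ∈ evenSpan k := mul_skConj_mem (c₀ : SkewPlane k)
  have hcQ := hf.commute_map (hcomm hc)
  have hbQ := hf.commute_map (hcomm (e := b * star b) (mul_skConj_mem (b : SkewPlane k)))
  set z := star a * a * (b * star b) with hzdef
  have hz0 : z ≠ 0 := mul_ne_zero (mul_ne_zero (hstar0 ha) ha) (mul_ne_zero hb (hstar0 hb))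
  have hz0' : (z : SkewPlane k) ≠ 0 := by simpa using hz0
  have hz : ∀ r ∈ R', ∃ s, f z * r = f s := by
    intro r hr
    obtain ⟨s, hs⟩ := hab r hr
    refine ⟨star a * s * star b, ?_⟩
    rw [hzdef, map_mul, mul_assoc, (hbQ r).eq, map_mul, map_mul, map_mul, map_mul, hs]
    simp only [mul_assoc]
  have hpow : ∀ x ∈ R', ∀ y : S, x * f c = f y →
      ∀ i : ℕ, ∃ s : SkewPlane k, (z : SkewPlane k) * y ^ i = s * (c : SkewPlane k) ^ i := by
    intro x hx y hxy i
    obtain ⟨s, hs⟩ := hz _ (pow_mem hx i)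
    refine ⟨s, ?_⟩
    have h : z * y ^ i = s * c ^ i := hf.injective (by
      rw [map_mul, map_mul f s, ← hs, map_pow, map_pow, ← hxy, (hcQ x).symm.mul_pow, mul_assoc])
    simpa using congrArg Subtype.val h
  suffices H : ∀ N : WithBot ℕ, ∀ y : S, ∀ x ∈ R', (skGrade k (y : SkewPlane k)).degree = N →
      x * f c = f y → x ∈ f.range by
    refine H _ (y₀ * star c₀) x hx rfl ?_
    rw [hcdef, map_mul, ← mul_assoc, hxc₀, map_mul]
  intro N
  induction N using WellFoundedLT.induction with
  | ind N ih =>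
  intro y x hx hN hxy
  by_cases hy0 : y = 0
  · rw [hy0, map_zero, (hf.isUnit_of_ne_zero hc0).mul_left_eq_zero] at hxy
    rw [hxy]
    exact zero_mem _
  have hy0' : (y : SkewPlane k) ≠ 0 := by simpa using hy0
  have hΦy : skGrade k (y : SkewPlane k) ≠ 0 := by
    rwa [Ne, map_eq_zero_iff _ skGrade_injective]
  have hΦc : skGrade k (c : SkewPlane k) ≠ 0 := by
    rwa [Ne, map_eq_zero_iff _ skGrade_injective]
  obtain ⟨t, ht⟩ : ∃ t, (skGrade k (y : SkewPlane k)).leadingCoeff =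
      t * (skGrade k (c : SkewPlane k)).leadingCoeff := by
    rcases Nat.even_or_odd (skGrade k (y : SkewPlane k)).natDegree with hd | hd
    · exact exists_leadingCoeff_eq_mul hz0' hc0' hc hd (hpow x hx y hxy)
    have hnodd := odd_of_map_coeff_eq hn hω hγu hγv hd (leadingCoeff_ne_zero.2 hΦy)
      (hγcoeff _ y.2 _)
    have hmul : ∀ (w : SkewPlane k) (e : ℕ), w ∈ S → w ≠ 0 → Odd e →
        skGrade k w = monomial e w → ∃ s, (skGrade k (y : SkewPlane k)).leadingCoeff * w =
          s * (skGrade k (c : SkewPlane k)).leadingCoeff := by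
      intro w e hw hw0 he hΦ
      have hΦw : skGrade k w ≠ 0 := by rwa [Ne, map_eq_zero_iff _ skGrade_injective]
      have h := exists_leadingCoeff_eq_mul (y := (y * ⟨w, hw⟩ : S)) hz0' hc0' hc
        (by
          rw [Subring.coe_mul, map_mul, natDegree_mul hΦy hΦw, hΦ, natDegree_monomial_eq _ hw0]
          exact hd.add_odd he)
        (hpow (x * f ⟨w, hw⟩) (mul_mem hx (hR ⟨_, rfl⟩)) _
          (by rw [mul_assoc, ← (hcQ _).eq, ← mul_assoc, hxy, map_mul]))
      rwa [Subring.coe_mul, map_mul, leadingCoeff_mul, hΦ, leadingCoeff_monomial] at h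
    exact exists_eq_mul_of_dihedral hnodd (leadingCoeff_ne_zero.2 hΦc)
      (coeff_skGrade_mem_evenSpan hc _)
      (hmul _ n hsum (dihedralSum_ne_zero n hn) hnodd (skGrade_dihedralSum n))
      (hmul _ (n + 2) hdiff (dihedralDiff_ne_zero n hn) (hnodd.add_even even_two)
        (skGrade_dihedralDiff n))
  have hC0 : (skGrade k (c : SkewPlane k)).leadingCoeff ≠ 0 := leadingCoeff_ne_zero.2 hΦc
  have hY0 : (skGrade k (y : SkewPlane k)).leadingCoeff ≠ 0 := leadingCoeff_ne_zero.2 hΦy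
  have htS : t ∈ S := by
    rw [hS]
    constructor
    · have h := congrArg γ ht
      rw [map_mul, leadingCoeff, leadingCoeff, hγcoeff _ y.2, hγcoeff _ c.2] at h
      exact mul_right_cancel₀ hC0 (h.symm.trans ht)
    · have h := congrArg η ht
      rw [map_mul, leadingCoeff, leadingCoeff, hηcoeff _ y.2, hηcoeff _ c.2] at h
      exact mul_right_cancel₀ hC0 (h.symm.trans ht)
  have hΦt : skGrade k t * monomial (skGrade k (c : SkewPlane k)).natDegree
      (skGrade k (c : SkewPlane k)).leadingCoeff =
      monomial (skGrade k (y : SkewPlane k)).natDegree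
        (skGrade k (y : SkewPlane k)).leadingCoeff := by
    have h := congrArg (skGrade k) ht
    rw [map_mul, leadingCoeff, leadingCoeff, skGrade_coeff, skGrade_coeff] at h
    exact h.symm
  have hΦt0 : skGrade k t ≠ 0 := by
    intro h
    rw [h, zero_mul, eq_comm, monomial_eq_zero_iff] at hΦt
    exact hY0 hΦt
  have hdeg := congrArg natDegree hΦt
  rw [natDegree_mul hΦt0 (by rwa [Ne, monomial_eq_zero_iff]), natDegree_monomial_eq _ hC0,
    natDegree_monomial_eq _ hY0] at hdeg
  have hlc := congrArg leadingCoeff hΦt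
  rw [leadingCoeff_mul, leadingCoeff_monomial, leadingCoeff_monomial] at hlc
  have hlt : (skGrade k ((y - ⟨t, htS⟩ * c : S) : SkewPlane k)).degree < N := by
    rw [AddSubgroupClass.coe_sub, Subring.coe_mul, map_sub, map_mul, ← hN]
    refine degree_sub_lt_left ?_ hΦy ?_
    · rw [degree_eq_natDegree hΦy, degree_eq_natDegree (mul_ne_zero hΦt0 hΦc),
        natDegree_mul hΦt0 hΦc, hdeg]
    · rw [leadingCoeff_mul, hlc]
  have hmem := ih _ hlt _ (x - f ⟨t, htS⟩) (sub_mem hx (hR ⟨_, rfl⟩)) rfl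
    (by rw [sub_mul, hxy, map_sub, map_mul f ⟨t, htS⟩])
  have := add_mem hmem (⟨⟨t, htS⟩, rfl⟩ : f ⟨t, htS⟩ ∈ f.range)
  rwa [sub_add_cancel] at this

end Dihedral

section FixedSubring

variable {G A : Type*} [Group G] [Ring A] [MulSemiringAction G A]

theorem pow_smul_eq_self {g : G} {a : A} (h : g • a = a) (i : ℕ) : g ^ i • a = a :=
  pow_mem (S := MulAction.stabilizer G a) (x := g) h i

theorem mem_fixedSubring_of_forall_eq_pow {g : G} (hg : ∀ x : G, ∃ i : ℕ, x = g ^ i) (a : A) :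
    a ∈ fixedSubring G A ↔ g • a = a := by
  refine ⟨fun h => h g, fun h x => ?_⟩
  obtain ⟨i, rfl⟩ := hg x
  exact pow_smul_eq_self h i

theorem mem_fixedSubring_of_forall_eq_or {h : G} (hh : ∀ x : G, x = 1 ∨ x = h) (a : A) :
    a ∈ fixedSubring G A ↔ h • a = a :=
  mem_fixedSubring_of_forall_eq_pow
    (fun x => (hh x).elim (fun hx => ⟨0, by rw [hx, pow_zero]⟩) fun hx => ⟨1, by rw [hx, pow_one]⟩) a

theorem mem_fixedSubring_of_forall_eq_pow_mul {g h : G}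
    (hgh : ∀ x : G, ∃ i : ℕ, x = g ^ i ∨ x = g ^ i * h) (a : A) :
    a ∈ fixedSubring G A ↔ g • a = a ∧ h • a = a := by
  refine ⟨fun H => ⟨H g, H h⟩, fun H x => ?_⟩
  obtain ⟨i, rfl | rfl⟩ := hgh x
  · exact pow_smul_eq_self H.1 i
  · rw [mul_smul, H.2]
    exact pow_smul_eq_self H.1 i

end FixedSubring

theorem quantumKleinian_singularity_maximalOrder
    (k : Type) [Field k] [IsAlgClosed k] [CharZero k] :
    (∀ (n : ℕ), 0 < n → ∀ ω : k, IsPrimitiveRoot ω n → ∀ q : k, q ≠ 0 →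
      ∀ (G : Type) [Group G] [Fintype G], ∀ g : G,
        orderOf g = n → (∀ x : G, ∃ i : ℕ, x = g ^ i) →
      ∀ [MulSemiringAction G (QuantumPlane k q)] [SMulCommClass G k (QuantumPlane k q)],
        g • qU k q = ω • qU k q → g • qV k q = ω⁻¹ • qV k q →
      ∀ (Q : Type) [Ring Q], ∀ f : ↥(fixedSubring G (QuantumPlane k q)) →+* Q,
        IsGoldieQuotientRing f → IsMaximalOrder f) ∧
    (∀ (G : Type) [Group G] [Fintype G], ∀ h : G,
        orderOf h = 2 → (∀ x : G, x = 1 ∨ x = h) →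
      ∀ [MulSemiringAction G (QuantumPlane k (-1 : k))] [SMulCommClass G k (QuantumPlane k (-1 : k))],
        h • qU k (-1 : k) = qV k (-1 : k) → h • qV k (-1 : k) = qU k (-1 : k) →
      ∀ (Q : Type) [Ring Q], ∀ f : ↥(fixedSubring G (QuantumPlane k (-1 : k))) →+* Q,
        IsGoldieQuotientRing f → IsMaximalOrder f) ∧
    (∀ (n : ℕ), 0 < n → ∀ ω : k, IsPrimitiveRoot ω n →
      ∀ (G : Type) [Group G] [Fintype G], ∀ g h : G,
        orderOf g = n → orderOf h = 2 → h * g * h = g⁻¹ →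
        Fintype.card G = 2 * n →
        (∀ x : G, ∃ i : ℕ, x = g ^ i ∨ x = g ^ i * h) →
      ∀ [MulSemiringAction G (QuantumPlane k (-1 : k))] [SMulCommClass G k (QuantumPlane k (-1 : k))],
        g • qU k (-1 : k) = ω • qU k (-1 : k) →
        g • qV k (-1 : k) = ω⁻¹ • qV k (-1 : k) →
        h • qU k (-1 : k) = qV k (-1 : k) → h • qV k (-1 : k) = qU k (-1 : k) →
      ∀ (Q : Type) [Ring Q], ∀ f : ↥(fixedSubring G (QuantumPlane k (-1 : k))) →+* Q,
        IsGoldieQuotientRing f → IsMaximalOrder f) ∧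
    (∀ (G : Type) [Group G] [Fintype G], ∀ h : G,
        orderOf h = 2 → (∀ x : G, x = 1 ∨ x = h) →
      ∀ [MulSemiringAction G (JordanPlane k)] [SMulCommClass G k (JordanPlane k)],
        h • jU k = - jU k → h • jV k = - jV k →
      ∀ (Q : Type) [Ring Q], ∀ f : ↥(fixedSubring G (JordanPlane k)) →+* Q,
        IsGoldieQuotientRing f → IsMaximalOrder f) := by
  refine ⟨?_, ?_, ?_, ?_⟩
  · intro n _ ω _ q hq G _ _ g _ hG _ _ hgu hgv Q _ f hf
    exact (isPlane_quantumPlane hq).isMaximalOrder_diagonal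
      (γ := MulSemiringAction.toAlgHom k (QuantumPlane k q) g) hgu hgv
      (mem_fixedSubring_of_forall_eq_pow hG) hf
  · intro G _ _ h _ hG hact hcomm hhu hhv Q _ f hf
    let _ : MulSemiringAction G (SkewPlane k) := hact
    have : SMulCommClass G k (SkewPlane k) := hcomm
    exact isMaximalOrder_dihedral (n := 1) one_pos IsPrimitiveRoot.one
      (γ := AlgHom.id k (SkewPlane k))
      (η := MulSemiringAction.toAlgHom k (SkewPlane k) h)
      (by simp) (by simp) hhu hhv
      (fun a => (mem_fixedSubring_of_forall_eq_or hG a).trans (by simp)) hf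
  · intro n hn ω hω G _ _ g h _ _ _ _ hG hact hcomm hgu hgv hhu hhv Q _ f hf
    let _ : MulSemiringAction G (SkewPlane k) := hact
    have : SMulCommClass G k (SkewPlane k) := hcomm
    exact isMaximalOrder_dihedral hn hω
      (γ := MulSemiringAction.toAlgHom k (SkewPlane k) g)
      (η := MulSemiringAction.toAlgHom k (SkewPlane k) h)
      hgu hgv hhu hhv (mem_fixedSubring_of_forall_eq_pow_mul hG) hf
  · intro G _ _ h _ hG _ _ hhu hhv Q _ f hf
    exact isPlane_jordanPlane.isMaximalOrder_diagonal
      (γ := MulSemiringAction.toAlgHom k (JordanPlane k) h) (α := -1) (β := -1)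
      (hhu.trans (neg_one_smul k _).symm) (hhv.trans (neg_one_smul k _).symm)
      (mem_fixedSubring_of_forall_eq_or hG) hf
end

section
/- Let R be a prime Goldie ring which is a maximal order in its Goldie quotient ring, and let e ∈ R be a nonzero idempotent. Then the endomorphism ring of Re as a right module over the corner ring eRe is isomorphic to R; that is, End_{eRe}(Re) ≅ R. -/
/-- A (possibly noncommutative) ring is *prime* if `a R b = 0` implies `a = 0` or `b = 0`. -/
def IsPrimeRing (R : Type*) [Ring R] : Prop :=
  ∀ a b : R, (∀ x : R, a * x * b = 0) → a = 0 ∨ b = 0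

/-- The left ideal `Re = {x : x e = x}` of a ring `R`, for an idempotent `e`,
as an additive subgroup. -/
def rightPart {R : Type*} [Ring R] (e : R) : AddSubgroup R where
  carrier := {x | x * e = x}
  add_mem' := by
    intro a b ha hb
    simp only [Set.mem_setOf_eq] at *
    rw [add_mul, ha, hb]
  zero_mem' := by simp
  neg_mem' := by
    intro a ha
    simp only [Set.mem_setOf_eq] at *
    rw [neg_mul, ha]

/-- Two regular elements have a regular common left multiple. -/
theorem IsGoldieQuotientRing.exists_left_common {R Q : Type*} [Ring R] [Ring Q] {f : R →+* Q}
    (hQ : IsGoldieQuotientRing f) {s₁ s₂ : R} (h₁ : IsRegular s₁) (h₂ : IsRegular s₂) :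
    ∃ a b : R, IsRegular (b * s₂) ∧ a * s₁ = b * s₂ := by
  obtain ⟨u, hu⟩ := hQ.isUnit_of_regular s₁ h₁
  obtain ⟨a, w, hw, h⟩ := hQ.left_fraction (f s₂ * ↑u⁻¹)
  refine ⟨a, w, hw.mul h₂, hQ.injective ?_⟩
  rw [map_mul, map_mul, ← h, ← hu, mul_assoc, mul_assoc, Units.inv_mul, mul_one]

/-- Right Ore condition: an element and a regular element have a common right multiple. -/
theorem IsGoldieQuotientRing.exists_right_ore {R Q : Type*} [Ring R] [Ring Q] {f : R →+* Q}
    (hQ : IsGoldieQuotientRing f) (x : R) {c : R} (hc : IsRegular c) :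
    ∃ s t : R, IsRegular s ∧ x * s = c * t := by
  obtain ⟨u, hu⟩ := hQ.isUnit_of_regular c hc
  obtain ⟨t, s, hs, h⟩ := hQ.right_fraction (↑u⁻¹ * f x)
  refine ⟨s, t, hs, hQ.injective ?_⟩
  rw [map_mul, map_mul, ← h, ← hu, mul_assoc, Units.mul_inv_cancel_left]

/-- The elements of the quotient ring which can be moved into a two-sided ideal `J` of `R` by
multiplying with regular elements on both sides. -/
def TwoSidedIdeal.fractions {R Q : Type*} [Ring R] [Ring Q] {f : R →+* Q}
    (hQ : IsGoldieQuotientRing f) (J : TwoSidedIdeal R) : TwoSidedIdeal Q :=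
  .mk' {q | ∃ s t j : R, IsRegular s ∧ IsRegular t ∧ j ∈ J ∧ f s * q * f t = f j}
    ⟨1, 1, 0, isRegular_one, isRegular_one, J.zero_mem, by simp⟩
    (by
      rintro p q ⟨s₁, t₁, j₁, hs₁, ht₁, hj₁, h₁⟩ ⟨s₂, t₂, j₂, hs₂, ht₂, hj₂, h₂⟩
      obtain ⟨a, b, hb, hab⟩ := hQ.exists_left_common hs₁ hs₂
      obtain ⟨c, d, hc, hcd⟩ := hQ.exists_right_ore t₁ ht₂
      refine ⟨b * s₂, t₁ * c, a * j₁ * c + b * j₂ * d, hb, ht₁.mul hc,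
        J.add_mem (J.mul_mem_right _ _ (J.mul_mem_left _ _ hj₁))
          (J.mul_mem_right _ _ (J.mul_mem_left _ _ hj₂)), ?_⟩
      rw [mul_add, add_mul]
      nth_rewrite 1 [← hab]
      nth_rewrite 2 [hcd]
      simp only [map_mul, map_add, ← h₁, ← h₂, mul_assoc])
    (by
      rintro p ⟨s, t, j, hs, ht, hj, h⟩
      exact ⟨s, t, -j, hs, ht, J.neg_mem hj, by simp [h]⟩)
    (by
      rintro p q ⟨s, t, j, hs, ht, hj, h⟩
      obtain ⟨u, hu⟩ := hQ.isUnit_of_regular s hs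
      obtain ⟨a, w, hw, haw⟩ := hQ.left_fraction (p * ↑u⁻¹)
      refine ⟨w, t, a * j, hw, ht, J.mul_mem_left _ _ hj, ?_⟩
      rw [map_mul, ← h, ← haw, ← hu]
      simp only [mul_assoc, Units.inv_mul_cancel_left])
    (by
      rintro p q ⟨s, t, j, hs, ht, hj, h⟩
      obtain ⟨u, hu⟩ := hQ.isUnit_of_regular t ht
      obtain ⟨a, w, hw, haw⟩ := hQ.right_fraction (↑u⁻¹ * q)
      refine ⟨s, w, j * a, hs, hw, J.mul_mem_right _ _ hj, ?_⟩
      rw [map_mul, ← h, ← haw, ← hu]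
      simp only [mul_assoc, Units.mul_inv_cancel_left])

/-- A nonzero two-sided ideal of an order in a simple ring contains a regular element. -/
theorem IsGoldieQuotientRing.exists_isRegular_mem {R Q : Type*} [Ring R] [Ring Q] [IsSimpleRing Q]
    {f : R →+* Q} (hQ : IsGoldieQuotientRing f) (J : TwoSidedIdeal R) {e : R} (he : e ∈ J)
    (he0 : e ≠ 0) : ∃ c ∈ J, IsRegular c := by
  have hmem : ∀ q, q ∈ J.fractions hQ ↔
      ∃ s t j : R, IsRegular s ∧ IsRegular t ∧ j ∈ J ∧ f s * q * f t = f j := fun q =>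
    TwoSidedIdeal.mem_mk' _ _ _ _ _ _ _
  have hfe : f e ∈ J.fractions hQ :=
    (hmem _).2 ⟨1, 1, e, isRegular_one, isRegular_one, he, by simp⟩
  have htop : J.fractions hQ = ⊤ := by
    refine (eq_bot_or_eq_top _).resolve_left fun h => he0 (hQ.injective ?_)
    rwa [h, TwoSidedIdeal.mem_bot, ← map_zero f] at hfe
  obtain ⟨s, t, j, hs, ht, hj, h⟩ := (hmem 1).1 (htop ▸ trivial)
  refine ⟨j, hj, ?_⟩
  rw [mul_one, ← map_mul] at h
  exact hQ.injective h ▸ hs.mul ht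

/-- In a prime ring, elements are determined by their products with `R e` for `e ≠ 0`. -/
theorem IsPrimeRing.eq_of_mul_mul_eq {R : Type*} [Ring R] (hR : IsPrimeRing R) {e a b : R}
    (he : e ≠ 0) (h : ∀ r, a * r * e = b * r * e) : a = b :=
  sub_eq_zero.1 <| (hR (a - b) e fun r => by rw [sub_mul, sub_mul, h, sub_self]).resolve_right he

/-- The elements `u` such that, for every `a`, the map `r ↦ g (a u r)` agrees on `R e` with left
multiplication by an element of `R`. -/
def multiplierIdeal {R : Type*} [Ring R] (g : R →+ R) (e : R) : TwoSidedIdeal R :=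
  .mk' {u | ∀ a, ∃ v, ∀ r, g (a * u * r * e) = v * r * e}
    (fun a => ⟨0, fun r => by simp⟩)
    (fun {x y} hx hy a => by
      obtain ⟨v, hv⟩ := hx a
      obtain ⟨w, hw⟩ := hy a
      exact ⟨v + w, fun r => by simp only [mul_add, add_mul, map_add, hv, hw]⟩)
    (fun {x} hx a => by
      obtain ⟨v, hv⟩ := hx a
      exact ⟨-v, fun r => by simp only [mul_neg, neg_mul, map_neg, hv]⟩)
    (fun {x y} hy a => by
      obtain ⟨v, hv⟩ := hy (a * x)
      exact ⟨v, fun r => by rw [← hv, mul_assoc a x y]⟩)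
    (fun {x y} hx a => by
      obtain ⟨v, hv⟩ := hx a
      exact ⟨v * y, fun r => by rw [mul_assoc v, ← hv]; simp only [mul_assoc]⟩)

/-- The elements of `Q` mapping the left ideal `R e` into itself by left multiplication. -/
def rightPartStabilizer {R Q : Type*} [Ring R] [Ring Q] (f : R →+* Q) (e : R) : Subring Q where
  carrier := {q | ∀ x ∈ rightPart e, ∃ y ∈ rightPart e, q * f x = f y}
  mul_mem' {p q} hp hq x hx := by
    obtain ⟨y, hy, hxy⟩ := hq x hx
    obtain ⟨z, hz, hyz⟩ := hp y hy
    exact ⟨z, hz, by rw [mul_assoc, hxy, hyz]⟩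
  one_mem' x hx := ⟨x, hx, one_mul _⟩
  add_mem' {p q} hp hq x hx := by
    obtain ⟨y, hy, hxy⟩ := hp x hx
    obtain ⟨z, hz, hxz⟩ := hq x hx
    exact ⟨y + z, add_mem hy hz, by rw [add_mul, hxy, hxz, map_add]⟩
  zero_mem' x hx := ⟨0, zero_mem _, by simp⟩
  neg_mem' {p} hp x hx := by
    obtain ⟨y, hy, hxy⟩ := hp x hx
    exact ⟨-y, neg_mem hy, by rw [neg_mul, hxy, map_neg]⟩

/-- A maximal order contains every element of `Q` stabilizing `R e`. -/
theorem IsMaximalOrder.rightPartStabilizer_le {R Q : Type*} [Ring R] [Ring Q] {f : R →+* Q}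
    (hmax : IsMaximalOrder f) {e : R} (he : e * e = e) (he0 : e ≠ 0) :
    rightPartStabilizer f e ≤ f.range := by
  have hle : f.range ≤ rightPartStabilizer f e := by
    rintro _ ⟨ρ, rfl⟩ x hx
    exact ⟨ρ * x, (mul_assoc ρ x e).trans (congrArg (ρ * ·) hx), (map_mul f ρ x).symm⟩
  by_contra hnot
  have : Nontrivial R := ⟨e, 0, he0⟩
  refine hmax ⟨_, lt_of_le_not_ge hle hnot, 1, e, one_ne_zero, he0, fun q hq => ?_⟩
  obtain ⟨y, -, hy⟩ := hq e he
  exact ⟨y, by rw [map_one, one_mul, hy]⟩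

/-- An additive map compatible with right multiplication by the corner ring is, on `R e`, left
multiplication by an element of the quotient ring. -/
theorem IsGoldieQuotientRing.exists_mul_eq {R Q : Type*} [Ring R] [Ring Q] [IsSimpleRing Q]
    {f : R →+* Q} (hQ : IsGoldieQuotientRing f) (hR : IsPrimeRing R) {e : R}
    (he0 : e ≠ 0) (g : R →+ R) (hg : ∀ u r, g (u * e * r * e) = g (u * e) * r * e) :
    ∃ q : Q, ∀ x ∈ rightPart e, q * f x = f (g x) := by
  have hmem : ∀ u, u ∈ multiplierIdeal g e ↔ ∀ a, ∃ v, ∀ r, g (a * u * r * e) = v * r * e :=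
    fun u => TwoSidedIdeal.mem_mk' _ _ _ _ _ _ _
  obtain ⟨c, hcJ, hc⟩ := hQ.exists_isRegular_mem (multiplierIdeal g e)
    ((hmem e).2 fun a => ⟨g (a * e), hg a⟩) he0
  obtain ⟨d, hd⟩ := (hmem c).1 hcJ 1
  obtain ⟨u, hu⟩ := hQ.isUnit_of_regular c hc
  refine ⟨f d * ↑u⁻¹, fun x hx => ?_⟩
  obtain ⟨s, t, hs, hst⟩ := hQ.exists_right_ore x hc
  have hgs : g x * s = d * t := hR.eq_of_mul_mul_eq he0 fun r => by
    have h₁ := hg x (s * r)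
    rw [show x * e = x from hx] at h₁
    have h₂ := hd (t * r)
    rw [one_mul, ← mul_assoc c, ← hst, mul_assoc x, h₁] at h₂
    simpa only [mul_assoc] using h₂
  refine (hQ.isUnit_of_regular s hs).mul_right_cancel ?_
  rw [← map_mul f (g x), hgs, mul_assoc, ← map_mul, hst, map_mul, map_mul, ← hu, mul_assoc,
    Units.inv_mul_cancel_left]

/-- If `R` is a prime Goldie maximal order and `e` is a nonzero idempotent, then the
canonical map `R → End_{eRe}(Re)` (by left multiplication) is bijective, i.e.
`End_{eRe}(Re) ≅ R`. -/
theorem endomorphism_ring_of_corner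
    (R : Type*) [Ring R] (hprime : IsPrimeRing R)
    (Q : Type*) [Ring Q] (f : R →+* Q) (hQ : IsGoldieQuotientRing f)
    [IsSimpleRing Q] (hart : IsArtinianRing Q)
    (hmax : IsMaximalOrder f)
    (e : R) (he : e * e = e) (he0 : e ≠ 0) :
    (∀ φ : ↥(rightPart e) →+ ↥(rightPart e),
      (∀ (x : ↥(rightPart e)) (r : R),
        φ ⟨(x : R) * (e * r * e), by
            show ((x : R) * (e * r * e)) * e = (x : R) * (e * r * e)
            rw [mul_assoc, mul_assoc (e * r), he]⟩ =
          ⟨(φ x : R) * (e * r * e), by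
            show ((φ x : R) * (e * r * e)) * e = (φ x : R) * (e * r * e)
            rw [mul_assoc, mul_assoc (e * r), he]⟩) →
      ∃ ρ : R, ∀ x : ↥(rightPart e), (φ x : R) = ρ * (x : R)) ∧
    (∀ ρ ρ' : R, (∀ x : ↥(rightPart e), ρ * (x : R) = ρ' * (x : R)) → ρ = ρ') := by
  refine ⟨fun φ hφ => ?_, fun ρ ρ' h => ?_⟩
  · let p : R →+ rightPart e :=
      { toFun := fun u => ⟨u * e, by
          show u * e * e = u * e
          rw [mul_assoc, he]⟩
        map_zero' := Subtype.ext (zero_mul e)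
        map_add' := fun u v => Subtype.ext (add_mul u v e) }
    have hp : ∀ x : rightPart e, p x = x := fun x => Subtype.ext x.2
    let g : R →+ R := (rightPart e).subtype.comp (φ.comp p)
    have hgx : ∀ x : rightPart e, g x = φ x := fun x =>
      congrArg (fun y => (φ y : R)) (hp x)
    have hge : ∀ u, g u * e = g u := fun u => (φ (p u)).2
    have hg : ∀ u r, g (u * e * r * e) = g (u * e) * r * e := fun u r => by
      have h := congrArg Subtype.val (hφ (p (u * e)) r)
      have h' : g (u * e * r * e) = g (u * e) * (e * r * e) := by
        refine Eq.trans (congrArg (fun y => (φ y : R)) (Subtype.ext ?_)) h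
        change u * e * r * e * e = u * e * e * (e * r * e)
        simp only [mul_assoc, he]
        simp only [← mul_assoc, he]
      rw [h', ← mul_assoc, ← mul_assoc, hge]
    obtain ⟨q, hq⟩ := hQ.exists_mul_eq hprime he0 g hg
    obtain ⟨ρ, rfl⟩ := hmax.rightPartStabilizer_le he he0
      (show q ∈ rightPartStabilizer f e from fun x hx => ⟨g x, hge x, hq x hx⟩)
    refine ⟨ρ, fun x => hQ.injective ?_⟩
    rw [map_mul, hq x x.2, hgx]
  · refine hprime.eq_of_mul_mul_eq he0 fun r => ?_
    have hr : r * e ∈ rightPart e := by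
      show r * e * e = r * e
      rw [mul_assoc, he]
    simpa only [mul_assoc] using h ⟨r * e, hr⟩
end
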